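/- arXiv:2501.07791 — 4 statements merged into one kernel-verified Lean document; each statement's English description precedes it below -/
import Mathlib

section
/- Let p be a prime and let π : G_p → U(n) be an irreducible n-dimensional unitary representation (i.e., a group homomorphism into the n×n unitary matrices such that the only subspaces of ℂⁿ invariant under all π(g) are 0 and ℂⁿ). Then p does not divide n, and there exist characters χ₁, χ₂ of ℤ[1/p] and a complex number λ with |λ| = 1 such that χ₁ has order exactly n in the dual group and, for all (a,b,c) ∈ G_p: Tr_n(π(a,b,c)) = χ₁(a)χ₂(b)λ^c if χ₁(b) = 1 and n divides c, and Tr_n(π(a,b,c)) = 0 otherwise. -/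
open Filter Topology

/-- `ℤ[1/p]` as an additive subgroup of `ℚ`: rationals of the form `k / p^n`. -/
def Zp (p : ℕ) : AddSubgroup ℚ where
  carrier := {q : ℚ | ∃ (k : ℤ) (n : ℕ), q * (p : ℚ) ^ n = (k : ℚ)}
  zero_mem' := ⟨0, 0, by norm_num⟩
  add_mem' := by
    rintro a b ⟨k1, n1, h1⟩ ⟨k2, n2, h2⟩
    refine ⟨k1 * (p : ℤ) ^ n2 + k2 * (p : ℤ) ^ n1, n1 + n2, ?_⟩
    push_cast
    calc (a + b) * (p : ℚ) ^ (n1 + n2)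
        = a * (p : ℚ) ^ n1 * (p : ℚ) ^ n2 + b * (p : ℚ) ^ n2 * (p : ℚ) ^ n1 := by
          rw [pow_add]; ring
      _ = (k1 : ℚ) * (p : ℚ) ^ n2 + (k2 : ℚ) * (p : ℚ) ^ n1 := by rw [h1, h2]
  neg_mem' := by
    rintro a ⟨k, n, h⟩
    refine ⟨-k, n, ?_⟩
    push_cast
    rw [neg_mul, h]

lemma one_mem_Zp (p : ℕ) : (1 : ℚ) ∈ Zp p := ⟨1, 0, by norm_num⟩

/-- The group `G_p = ℤ[1/p]² ⋊ ℤ`, realized as triples `(a, b, c)` with the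
multiplication `(a₁,b₁,c₁)(a₂,b₂,c₂) = (a₁+a₂+c₁b₂, b₁+b₂, c₁+c₂)`. -/
abbrev Gp (p : ℕ) : Type := Zp p × Zp p × ℤ

instance Gp.instGroup (p : ℕ) : Group (Gp p) where
  mul x y := ⟨x.1 + y.1 + x.2.2 • y.2.1, x.2.1 + y.2.1, x.2.2 + y.2.2⟩
  one := ⟨0, 0, 0⟩
  inv x := ⟨-x.1 + x.2.2 • x.2.1, -x.2.1, -x.2.2⟩
  mul_assoc x y z := by
    refine Prod.ext ?_ (Prod.ext ?_ ?_)
    · show x.1 + y.1 + x.2.2 • y.2.1 + z.1 + (x.2.2 + y.2.2) • z.2.1 =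
        x.1 + (y.1 + z.1 + y.2.2 • z.2.1) + x.2.2 • (y.2.1 + z.2.1)
      rw [add_smul, smul_add]; abel
    · show x.2.1 + y.2.1 + z.2.1 = x.2.1 + (y.2.1 + z.2.1)
      rw [add_assoc]
    · show x.2.2 + y.2.2 + z.2.2 = x.2.2 + (y.2.2 + z.2.2)
      rw [add_assoc]
  one_mul x := by
    refine Prod.ext ?_ (Prod.ext ?_ ?_)
    · show 0 + x.1 + (0 : ℤ) • x.2.1 = x.1
      simp
    · show 0 + x.2.1 = x.2.1
      simp
    · show 0 + x.2.2 = x.2.2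
      simp
  mul_one x := by
    refine Prod.ext ?_ (Prod.ext ?_ ?_)
    · show x.1 + 0 + x.2.2 • (0 : Zp p) = x.1
      simp
    · show x.2.1 + 0 = x.2.1
      simp
    · show x.2.2 + 0 = x.2.2
      simp
  inv_mul_cancel x := by
    refine Prod.ext ?_ (Prod.ext ?_ ?_)
    · show -x.1 + x.2.2 • x.2.1 + x.1 + (-x.2.2) • x.2.1 = 0
      rw [neg_smul]; abel
    · show -x.2.1 + x.2.1 = 0
      simp
    · show -x.2.2 + x.2.2 = 0
      simp

/-- The normalized trace of an `n × n` complex matrix (`trN n 1 = 1`). -/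
noncomputable def trN (n : ℕ) (A : Matrix (Fin n) (Fin n) ℂ) : ℂ :=
  A.trace / n

open Matrix in
/-- A commuting family of complex matrices has a common eigenvector. -/
lemma exists_common_eigenvector {ι : Type*} {n : ℕ} (hn : 0 < n)
    (T : ι → Matrix (Fin n) (Fin n) ℂ) (hT : ∀ i j, T i * T j = T j * T i) :
    ∃ v : Fin n → ℂ, v ≠ 0 ∧ ∀ i, ∃ c : ℂ, T i *ᵥ v = c • v := by
  have : Nonempty (Fin n) := ⟨⟨0, hn⟩⟩
  let P : ℕ → Prop := fun d => ∃ W : Submodule ℂ (Fin n → ℂ), W ≠ ⊥ ∧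
    (∀ i, ∀ v ∈ W, T i *ᵥ v ∈ W) ∧ Module.finrank ℂ W = d
  have hP : ∃ d, P d := ⟨_, ⊤, top_ne_bot, fun _ _ _ => trivial, rfl⟩
  classical
  obtain ⟨W, hW, hinv, hd⟩ := Nat.find_spec hP
  have hmin := fun d => Nat.find_min' hP (m := d)
  rw [← hd] at hmin
  obtain ⟨v, hv, hv0⟩ := W.exists_mem_ne_zero_of_ne_bot hW
  refine ⟨v, hv0, fun i => ?_⟩
  have : Nontrivial W := Submodule.nontrivial_iff_ne_bot.mpr hW
  obtain ⟨c, hc⟩ := Module.End.exists_eigenvalue ((toLin' (T i)).restrict (hinv i))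
  obtain ⟨w, hw⟩ := hc.exists_hasEigenvector
  let E : Submodule ℂ (Fin n → ℂ) := W ⊓ Module.End.eigenspace (toLin' (T i)) c
  have hE : ∀ x, x ∈ E ↔ x ∈ W ∧ T i *ᵥ x = c • x := fun x => by
    simp [E]
  have hEW : E = W := by
    refine Submodule.eq_of_le_of_finrank_le inf_le_left (hmin _ ⟨E, ?_, ?_, rfl⟩)
    · refine (Submodule.ne_bot_iff _).mpr ⟨w, (hE _).mpr ⟨w.2, ?_⟩, ?_⟩
      · exact congrArg Subtype.val hw.apply_eq_smul
      · simpa using hw.2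
    · intro j x hx
      obtain ⟨h1, h2⟩ := (hE x).mp hx
      refine (hE _).mpr ⟨hinv j x h1, ?_⟩
      rw [mulVec_mulVec, hT i j, ← mulVec_mulVec, h2, mulVec_smul]
  exact ⟨c, ((hE v).mp (hEW ▸ hv)).2⟩

open Matrix ComplexOrder in
/-- Eigenvalues of a unitary matrix have modulus one. -/
lemma norm_eq_one_of_unitary_mulVec {n : ℕ} (U : unitaryGroup (Fin n) ℂ) {v : Fin n → ℂ}
    (hv : v ≠ 0) {c : ℂ} (h : (U : Matrix (Fin n) (Fin n) ℂ) *ᵥ v = c • v) : ‖c‖ = 1 := by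
  have h1 : star (U.1 *ᵥ v) ⬝ᵥ (U.1 *ᵥ v) = star v ⬝ᵥ v := by
    rw [star_mulVec, ← dotProduct_mulVec, mulVec_mulVec, ← star_eq_conjTranspose,
      mem_unitaryGroup_iff'.mp U.2, one_mulVec]
  rw [h, star_smul, smul_dotProduct, dotProduct_smul, smul_smul, smul_eq_mul] at h1
  have h2 : star v ⬝ᵥ v ≠ 0 := fun h0 => hv (dotProduct_star_self_eq_zero.mp h0)
  have h3 : star c * c = 1 := mul_right_cancel₀ h2 (by rw [h1, one_mul])
  have h4 : ((‖c‖ : ℂ)) ^ 2 = 1 := by rw [← h3]; exact (Complex.conj_mul' c).symm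
  have h5 : ‖c‖ ^ 2 = 1 := by exact_mod_cast h4
  exact (pow_eq_one_iff_of_nonneg (norm_nonneg c) two_ne_zero).mp h5

open Matrix in
/-- A common eigenvector of a unitary representation of an additive group defines a character. -/
lemma exists_addChar_of_eigenvector {A : Type*} [AddCommGroup A] {n : ℕ}
    (F : A → unitaryGroup (Fin n) ℂ) (hF0 : F 0 = 1) (hF : ∀ a b, F (a + b) = F a * F b)
    {v : Fin n → ℂ} (hv : v ≠ 0)
    (h : ∀ a, ∃ c : ℂ, (F a : Matrix (Fin n) (Fin n) ℂ) *ᵥ v = c • v) :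
    ∃ χ : AddChar A Circle,
      ∀ a, (F a : Matrix (Fin n) (Fin n) ℂ) *ᵥ v = (χ a : ℂ) • v := by
  choose c hc using h
  have hnorm a : ‖c a‖ = 1 := norm_eq_one_of_unitary_mulVec (F a) hv (hc a)
  refine ⟨⟨fun a => ⟨c a, mem_sphere_zero_iff_norm.mpr (hnorm a)⟩, ?_, fun a b => ?_⟩,
    fun a => hc a⟩ <;> refine Circle.ext (smul_left_injective ℂ hv ?_)
  · change c 0 • v = (1 : ℂ) • v
    rw [← hc, hF0]
    simp
  · change c (a + b) • v = (c a * c b) • v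
    rw [← hc, hF, mul_comm, mul_smul, ← hc, ← mulVec_smul, ← hc]
    simp [mulVec_mulVec]

open Matrix in
/-- Schur's lemma, for a matrix with a given eigenvector. -/
lemma eq_smul_one_of_commute {G : Type*} [Group G] {n : ℕ} (π : G →* unitaryGroup (Fin n) ℂ)
    (hirr : ∀ W : Submodule ℂ (Fin n → ℂ),
      (∀ (g : G) (v : Fin n → ℂ), v ∈ W → (π g : Matrix (Fin n) (Fin n) ℂ) *ᵥ v ∈ W) →
      W = ⊥ ∨ W = ⊤)
    {M : Matrix (Fin n) (Fin n) ℂ} (hM : ∀ g, M * (π g).1 = (π g).1 * M)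
    {v : Fin n → ℂ} (hv : v ≠ 0) {c : ℂ} (h : M *ᵥ v = c • v) : M = c • 1 := by
  have hE : ∀ x, x ∈ Module.End.eigenspace (toLin' M) c ↔ M *ᵥ x = c • x := fun x => by
    simp
  rcases hirr (Module.End.eigenspace (toLin' M) c) (fun g x hx => by
    rw [hE] at hx ⊢
    rw [mulVec_mulVec, hM, ← mulVec_mulVec, hx, mulVec_smul]) with h0 | h1
  · exact absurd ((Submodule.eq_bot_iff _).mp h0 v ((hE v).mpr h)) hv
  · refine ext_of_mulVec_single fun i => ?_
    rw [smul_mulVec, one_mulVec]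
    exact (hE _).mp (h1 ▸ trivial)

open Matrix in
/-- A matrix that commutes up to a scalar `z ≠ 1` with an invertible matrix has trace zero. -/
lemma trace_eq_zero_of_mul_eq_smul_mul {n : ℕ} (U : unitaryGroup (Fin n) ℂ)
    {M : Matrix (Fin n) (Fin n) ℂ} {z : ℂ} (hz : z ≠ 1) (h : U.1 * M = z • (M * U.1)) :
    M.trace = 0 := by
  have h1 : M.trace = z * M.trace := by
    calc M.trace = (U.1 * M * star U.1).trace := by
          rw [trace_mul_comm, ← mul_assoc, mem_unitaryGroup_iff'.mp U.2, one_mul]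
      _ = z * M.trace := by
          rw [h, smul_mul, mul_assoc, mem_unitaryGroup_iff.mp U.2, mul_one, trace_smul,
            smul_eq_mul]
  have h2 : (1 - z) * M.trace = 0 := by linear_combination h1
  exact (mul_eq_zero.mp h2).resolve_left (sub_ne_zero.mpr hz.symm)

lemma Gp.mul_def {p : ℕ} (x y : Gp p) :
    x * y = (x.1 + y.1 + x.2.2 • y.2.1, x.2.1 + y.2.1, x.2.2 + y.2.2) := rfl

lemma Gp.one_def {p : ℕ} : (1 : Gp p) = (0, 0, 0) := rfl

/-- Every element of `ℤ[1/p]` is divisible by `p`. -/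
lemma Zp.exists_nsmul_eq {p : ℕ} (hp : p ≠ 0) (x : Zp p) : ∃ y : Zp p, p • y = x := by
  obtain ⟨q, k, m, h⟩ := x
  have hp' : (p : ℚ) ≠ 0 := by exact_mod_cast hp
  refine ⟨⟨q / p, k, m + 1, ?_⟩, Subtype.ext ?_⟩
  · rw [← h, pow_succ]; field_simp
  · simp; field_simp

/-- if `π` is an irreducible `n`-dimensional unitary representation of `G_p`,
then `p ∤ n` and there are characters `χ₁, χ₂` of `ℤ[1/p]`, with `χ₁` of order exactly `n`,
and `λ ∈ 𝕋` such that `Tr_n ∘ π (a,b,c) = χ₁(a)χ₂(b)λᶜ` when `χ₁(b) = 1` and `n ∣ c`,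
and `Tr_n ∘ π (a,b,c) = 0` otherwise. -/
theorem trace_of_irreducible_rep (p : ℕ) (hp : p.Prime) (n : ℕ) (hn : 0 < n)
    (π : Gp p →* Matrix.unitaryGroup (Fin n) ℂ)
    (hirr : ∀ W : Submodule ℂ (Fin n → ℂ),
      (∀ (g : Gp p) (v : Fin n → ℂ), v ∈ W → (π g : Matrix (Fin n) (Fin n) ℂ).mulVec v ∈ W) →
      W = ⊥ ∨ W = ⊤) :
    ¬ (p ∣ n) ∧
    ∃ (χ₁ χ₂ : AddChar (Zp p) Circle) (lam : ℂ), ‖lam‖ = 1 ∧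
      ((∀ x : Zp p, χ₁ x ^ n = 1) ∧
        ∀ j : ℕ, 1 ≤ j → (∀ x : Zp p, χ₁ x ^ j = 1) → n ≤ j) ∧
      ∀ g : Gp p,
        (χ₁ g.2.1 = 1 ∧ (n : ℤ) ∣ g.2.2 →
          trN n (π g) = (χ₁ g.1 : ℂ) * (χ₂ g.2.1 : ℂ) * lam ^ g.2.2) ∧
        (¬ (χ₁ g.2.1 = 1 ∧ (n : ℤ) ∣ g.2.2) → trN n (π g) = 0) := by
  have hmul g h : (π (g * h)).1 = (π g).1 * (π h).1 := by rw [map_mul]; rfl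
  obtain ⟨v, hv, hT⟩ := exists_common_eigenvector hn
    (fun x : Zp p × Zp p => (π (x.1, x.2, 0)).1) (fun x y => by
      simp only [← hmul]
      simp [Gp.mul_def, add_comm])
  obtain ⟨χ₁, hχ₁⟩ := exists_addChar_of_eigenvector (fun a : Zp p => π (a, 0, 0)) (map_one π)
    (fun a b => by simp [← map_mul, Gp.mul_def]) hv fun a => hT (a, 0)
  obtain ⟨χ₂, hχ₂⟩ := exists_addChar_of_eigenvector (fun b : Zp p => π (0, b, 0)) (map_one π)
    (fun a b => by simp [← map_mul, Gp.mul_def]) hv fun b => hT (0, b)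
  have hA (a : Zp p) : (π (a, 0, 0)).1 = (χ₁ a : ℂ) • 1 :=
    eq_smul_one_of_commute π hirr
      (fun g => by rw [← hmul, ← hmul]; simp [Gp.mul_def, add_comm]) hv (hχ₁ a)
  have hcomm (g h : Gp p) : (π g).1 * (π h).1 =
      (χ₁ (g.2.2 • h.2.1 - h.2.2 • g.2.1) : ℂ) • ((π h).1 * (π g).1) := by
    have key : g * h = (g.2.2 • h.2.1 - h.2.2 • g.2.1, 0, 0) * (h * g) := by
      simp only [Gp.mul_def, zero_smul, add_zero, zero_add]
      refine Prod.ext ?_ (Prod.ext (add_comm _ _) (add_comm _ _))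
      dsimp only
      abel
    rw [← hmul, ← hmul, key, hmul, hA, smul_mul_assoc, one_mul]
  have hcentral (g : Gp p) (hg : ∀ b : Zp p, χ₁ b ^ g.2.2 = 1) (hg' : χ₁ g.2.1 = 1)
      (h : Gp p) : (π g).1 * (π h).1 = (π h).1 * (π g).1 := by
    rw [hcomm, AddChar.map_sub_eq_div, AddChar.map_zsmul_eq_zpow, AddChar.map_zsmul_eq_zpow,
      hg, hg']
    simp
  have hpow (x : Zp p) : χ₁ x ^ n = 1 := by
    have h1 := congrArg Matrix.det (hcomm (0, 0, 1) (0, x, 0))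
    rw [Matrix.det_smul, Matrix.det_mul, Matrix.det_mul] at h1
    have hdet (g : Gp p) : (π g).1.det ≠ 0 := fun h0 => by
      have := congrArg Matrix.det (Matrix.mem_unitaryGroup_iff.mp (π g).2)
      rw [Matrix.det_mul, h0] at this
      simp at this
    have h2 : ((χ₁ x : ℂ)) ^ n = 1 := by
      refine mul_right_cancel₀ (mul_ne_zero (hdet (0, 0, 1)) (hdet (0, x, 0))) ?_
      simp at h1
      linear_combination -h1
    exact Circle.ext (by simpa using h2)
  have hmin (j : ℕ) (hj : 1 ≤ j) (hχj : ∀ x : Zp p, χ₁ x ^ j = 1) : n ≤ j := by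
    let w : ℤ → Fin n → ℂ := fun k => (π (0, 0, k)).1.mulVec v
    let W : Submodule ℂ (Fin n → ℂ) := Submodule.span ℂ (Set.range fun k : Fin j => w k)
    have hwW (k : ℤ) : w k ∈ W := by
      have hj0 : (j : ℤ) ≠ 0 := by omega
      obtain ⟨u, hu, hs⟩ := exists_common_eigenvector hn
        (fun _ : Unit => (π (0, 0, j * (k / j))).1) (fun _ _ => rfl)
      obtain ⟨s, hs⟩ := hs ()
      have hD := eq_smul_one_of_commute π hirr (hcentral (0, 0, j * (k / j))
        (fun b => by rw [zpow_mul, zpow_natCast, hχj, one_zpow]) (by simp)) hu hs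
      have hk : ((0, 0, k) : Gp p) = (0, 0, j * (k / j)) * (0, 0, k % j) := by
        simp [Gp.mul_def, Int.mul_ediv_add_emod]
      have hwk : w k = s • w (k % j) := by
        simp only [w]
        rw [hk, hmul, hD, smul_mul_assoc, one_mul, Matrix.smul_mulVec]
      rw [hwk]
      refine W.smul_mem _ (Submodule.subset_span ⟨⟨(k % j).toNat, ?_⟩, ?_⟩)
      · have := Int.emod_nonneg k hj0
        have := Int.emod_lt_of_pos k (b := j) (by omega)
        omega
      · simp only [Int.toNat_of_nonneg (Int.emod_nonneg k hj0)]
    have hWtop : W = ⊤ := by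
      refine (hirr W fun g x hx => ?_).resolve_left fun h0 => ?_
      · induction hx using Submodule.span_induction with
        | mem x hx =>
          obtain ⟨k, rfl⟩ := hx
          obtain ⟨c, hc⟩ := hT (g.1 - (g.2.2 + k) • g.2.1, g.2.1)
          have hg : g * (0, 0, (k : ℤ)) =
              (0, 0, g.2.2 + k) * (g.1 - (g.2.2 + k) • g.2.1, g.2.1, 0) := by
            simp [Gp.mul_def]
          have hgw : (π g).1.mulVec (w k) = c • w (g.2.2 + k) := by
            simp only [w]
            rw [Matrix.mulVec_mulVec, ← hmul, hg, hmul, ← Matrix.mulVec_mulVec, hc,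
              Matrix.mulVec_smul]
          rw [hgw]
          exact W.smul_mem _ (hwW _)
        | zero => simp
        | add x y _ _ hx hy => rw [Matrix.mulVec_add]; exact W.add_mem hx hy
        | smul c x _ hx => rw [Matrix.mulVec_smul]; exact W.smul_mem _ hx
      · have h1 : w 0 = v := by
          have : (π (0, 0, 0)).1 = 1 := congrArg Subtype.val (map_one π)
          simp [w, this]
        exact hv ((Submodule.eq_bot_iff _).mp h0 v (h1 ▸ hwW 0))
    have h2 : Module.finrank ℂ W ≤ j := by
      simpa [Set.finrank] using finrank_range_le_card (R := ℂ) (fun k : Fin j => w k)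
    rw [hWtop] at h2
    simpa using h2
  obtain ⟨χ₃, hχ₃⟩ := exists_addChar_of_eigenvector (fun q : ℤ => π (0, 0, n * q))
    (by simp only [mul_zero]; exact map_one π)
    (fun a b => by simp [← map_mul, Gp.mul_def, mul_add]) hv (fun q => by
      obtain ⟨u, hu, hs⟩ := exists_common_eigenvector hn
        (fun _ : Unit => (π (0, 0, n * q)).1) (fun _ _ => rfl)
      obtain ⟨s, hs⟩ := hs ()
      have hD := eq_smul_one_of_commute π hirr (hcentral (0, 0, n * q)
        (fun b => by rw [zpow_mul, zpow_natCast, hpow, one_zpow]) (by simp)) hu hs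
      exact ⟨s, by rw [hD, Matrix.smul_mulVec, Matrix.one_mulVec]⟩)
  obtain ⟨lam, hlam⟩ := IsAlgClosed.exists_pow_nat_eq (χ₃ 1 : ℂ) hn
  refine ⟨?_, χ₁, χ₂, lam, ?_, ⟨hpow, hmin⟩, fun g => ⟨?_, fun hg => ?_⟩⟩
  · rintro ⟨k, rfl⟩
    have hk : 0 < k := Nat.pos_of_mul_pos_left hn
    refine absurd (hmin k hk fun x => ?_) (not_le.mpr (lt_mul_of_one_lt_left hk hp.one_lt))
    obtain ⟨y, rfl⟩ := Zp.exists_nsmul_eq hp.ne_zero x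
    rw [AddChar.map_nsmul_eq_pow, ← pow_mul, hpow]
  · refine (pow_eq_one_iff_of_nonneg (norm_nonneg lam) hn.ne').mp ?_
    rw [← norm_pow, hlam, Circle.norm_coe]
  · obtain ⟨a, b, c⟩ := g
    rintro ⟨hb, q, hq⟩
    dsimp only at hb hq ⊢
    subst hq
    have hg : ((a, b, n * q) : Gp p) = (a, 0, 0) * ((0, b, 0) * (0, 0, n * q)) := by
      simp [Gp.mul_def]
    have hev : (π (a, b, n * q)).1.mulVec v =
        ((χ₁ a : ℂ) * χ₂ b * lam ^ ((n : ℤ) * q)) • v := by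
      rw [hg, hmul, hmul, ← Matrix.mulVec_mulVec, ← Matrix.mulVec_mulVec, hχ₃,
        Matrix.mulVec_smul, hχ₂, Matrix.mulVec_smul, Matrix.mulVec_smul, hχ₁, smul_smul,
        smul_smul, zpow_mul, zpow_natCast, hlam]
      have h3 : χ₃ q = χ₃ 1 ^ q := by rw [← AddChar.map_zsmul_eq_zpow]; simp
      rw [h3, Circle.coe_zpow]
      congr 1
      ring
    have hM := eq_smul_one_of_commute π hirr (hcentral (a, b, n * q)
      (fun b => by rw [zpow_mul, zpow_natCast, hpow, one_zpow]) hb) hv hev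
    have hn0 : (n : ℂ) ≠ 0 := by exact_mod_cast hn.ne'
    rw [trN, hM, Matrix.trace_smul, Matrix.trace_one, Fintype.card_fin, smul_eq_mul,
      mul_div_cancel_right₀ _ hn0]
  · obtain ⟨h, hh⟩ : ∃ h : Gp p, χ₁ (h.2.2 • g.2.1 - g.2.2 • h.2.1) ≠ 1 := by
      by_contra! hall
      have hb : χ₁ g.2.1 = 1 := by simpa using hall (0, 0, 1)
      have hc (x : Zp p) : χ₁ x ^ g.2.2 = 1 := by
        simpa [AddChar.map_neg_eq_inv, AddChar.map_zsmul_eq_zpow] using hall (0, x, 0)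
      refine hg ⟨hb, Int.dvd_of_emod_eq_zero ?_⟩
      by_contra hr
      have hn0 : (n : ℤ) ≠ 0 := by omega
      have h1 := Int.emod_nonneg g.2.2 hn0
      have h2 := Int.emod_lt_of_pos g.2.2 (b := n) (by omega)
      have h3 := hmin (g.2.2 % n).toNat (by omega) fun x => by
        rw [← zpow_natCast, Int.toNat_of_nonneg h1, Int.emod_def, zpow_sub, hc, zpow_mul,
          zpow_natCast, hpow]
        simp
      omega
    rw [trN, trace_eq_zero_of_mul_eq_smul_mul (π h) (mt Circle.coe_eq_one.mp hh) (hcomm h g), zero_div]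
end

section
/- Let p be a prime. Suppose (n_k) is a sequence of positive integers and π_k : G_p → U(n_k) is a sequence of group homomorphisms such that lim_k Tr_{n_k}(π_k(0,1,0)) = 1. Then for every a ∈ ℤ[1/p], lim_k Tr_{n_k}(π_k(a,0,0)) = 1. -/
open Filter Topology

open scoped Matrix

namespace HeisenbergTrace

variable {n : ℕ}

/-- If `A` is the commutator of `T` and `B` and commutes with both, then every eigenvalue of `A`
is a root of unity, by comparing determinants on the eigenspace. -/
lemma pow_factorial_eq_one_of_mem_spectrum {A B T : Matrix (Fin n) (Fin n) ℂ}
    (hB : IsUnit B) (hT : IsUnit T) (hAB : A * B = B * A) (hAT : A * T = T * A)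
    (h : T * B = A * (B * T)) {μ : ℂ} (hμ : μ ∈ spectrum ℂ A) : μ ^ n.factorial = 1 := by
  set a := Matrix.toLinAlgEquiv' A with ha
  set b := Matrix.toLinAlgEquiv' B with hb
  set t := Matrix.toLinAlgEquiv' T with ht
  have hab : a * b = b * a := by simp only [ha, hb, ← map_mul, hAB]
  have hat : a * t = t * a := by simp only [ha, ht, ← map_mul, hAT]
  have htb : t * b = a * (b * t) := by simp only [ha, hb, ht, ← map_mul, h]
  have hev : Module.End.HasEigenvalue a μ := by
    rw [Module.End.hasEigenvalue_iff_mem_spectrum, ha, AlgEquiv.spectrum_eq]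
    exact hμ
  let V := Module.End.eigenspace a μ
  have hbV : ∀ v ∈ V, b v ∈ V := Module.End.mapsTo_genEigenspace_of_comm hab μ 1
  have htV : ∀ v ∈ V, t v ∈ V := Module.End.mapsTo_genEigenspace_of_comm hat μ 1
  have det_ne : ∀ (f : Module.End ℂ (Fin n → ℂ)) (hf : IsUnit f) (hfV : ∀ v ∈ V, f v ∈ V),
      LinearMap.det (f.restrict hfV) ≠ 0 := by
    intro f hf hfV
    have hinj : Function.Injective (f.restrict hfV) := by
      intro x y hxy
      exact Subtype.ext (((Module.End.isUnit_iff f).1 hf).1 (congrArg Subtype.val hxy))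
    exact ((LinearMap.isUnit_iff_ker_eq_bot _).2 (LinearMap.ker_eq_bot.2 hinj)).map
      LinearMap.det |>.ne_zero
  have hrel : t.restrict htV * b.restrict hbV = μ • (b.restrict hbV * t.restrict htV) := by
    ext1 v
    apply Subtype.ext
    have h1 : t (b v) = a (b (t v)) := LinearMap.congr_fun htb v
    have h2 : a (b (t v)) = μ • b (t v) :=
      Module.End.mem_eigenspace_iff.1 (hbV _ (htV _ v.2))
    exact h1.trans h2
  have hdet := congrArg LinearMap.det hrel
  rw [LinearMap.det_smul, map_mul, map_mul, mul_comm (LinearMap.det (t.restrict htV))] at hdet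
  have hpow : μ ^ Module.finrank ℂ V = 1 := by
    have := mul_ne_zero (det_ne b (hB.map _) hbV) (det_ne t (hT.map _) htV)
    exact (mul_eq_right₀ this).1 hdet.symm
  have hpos : 0 < Module.finrank ℂ V :=
    Module.finrank_pos_iff.2 ((Submodule.nontrivial_iff_ne_bot).2 hev)
  have hle : Module.finrank ℂ V ≤ n := by
    simpa using V.finrank_le
  obtain ⟨c, hc⟩ := Nat.dvd_factorial hpos hle
  rw [hc, pow_mul, hpow, one_pow]

open scoped Matrix.Norms.L2Operator in
/-- A normal matrix all of whose eigenvalues are `N`-th roots of unity has order dividing `N`. -/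
lemma pow_eq_one_of_spectrum {A : Matrix (Fin n) (Fin n) ℂ} [IsStarNormal A] {N : ℕ}
    (h : ∀ μ ∈ spectrum ℂ A, μ ^ N = 1) : A ^ N = 1 := by
  rw [← cfc_pow_id (R := ℂ) A N, cfc_congr (g := fun _ => 1) (fun μ hμ => h μ hμ),
    cfc_const_one ℂ A]

lemma unitary_pow_factorial_eq_one {A B T : Matrix.unitaryGroup (Fin n) ℂ}
    (hAB : A * B = B * A) (hAT : A * T = T * A) (h : T * B = A * (B * T)) :
    A ^ n.factorial = 1 := by
  have hN : IsStarNormal (A : Matrix (Fin n) (Fin n) ℂ) :=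
    ⟨(Unitary.coe_star_mul_self A).trans (Unitary.coe_mul_star_self A).symm⟩
  have hu : ∀ U : Matrix.unitaryGroup (Fin n) ℂ, IsUnit (U : Matrix (Fin n) (Fin n) ℂ) :=
    fun U => (Unitary.toUnits U).isUnit
  apply Subtype.ext
  push_cast
  exact pow_eq_one_of_spectrum fun μ hμ => pow_factorial_eq_one_of_mem_spectrum (hu B) (hu T)
    (congrArg Subtype.val hAB) (congrArg Subtype.val hAT) (congrArg Subtype.val h) hμ

open scoped ComplexOrder in
lemma re_trace_unitary_mul_le {U P : Matrix (Fin n) (Fin n) ℂ}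
    (hU : U ∈ Matrix.unitaryGroup (Fin n) ℂ) (hP : IsStarProjection P) :
    (U * P).trace.re ≤ P.trace.re := by
  have hs : Pᴴ = P := hP.isSelfAdjoint
  have hi : P * P = P := hP.isIdempotentElem
  have hU' : Uᴴ * U = 1 := Matrix.mem_unitaryGroup_iff'.1 hU
  have hnn : 0 ≤ (((1 - U) * P)ᴴ * ((1 - U) * P)).trace.re :=
    (Complex.le_def.1 (Matrix.posSemidef_conjTranspose_mul_self _).trace_nonneg).1
  have e : ((1 - U) * P)ᴴ * ((1 - U) * P) = P * P + P * (Uᴴ * U) * P - P * (U * P) -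
      (U * P)ᴴ * P := by
    simp only [Matrix.conjTranspose_mul, Matrix.conjTranspose_sub, Matrix.conjTranspose_one, hs]
    noncomm_ring
  have t1 : (P * (U * P)).trace = (U * P).trace := by
    rw [Matrix.trace_mul_comm, mul_assoc, hi]
  have t2 : ((U * P)ᴴ * P).trace = star (U * P).trace := by
    rw [← t1, ← Matrix.trace_conjTranspose, Matrix.conjTranspose_mul P, hs]
  rw [e, hU', mul_one, hi, Matrix.trace_sub, Matrix.trace_sub, Matrix.trace_add, t1, t2] at hnn
  simp at hnn
  linarith

lemma norm_trace_unitary_mul_le {U P : Matrix (Fin n) (Fin n) ℂ}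
    (hU : U ∈ Matrix.unitaryGroup (Fin n) ℂ) (hP : IsStarProjection P) :
    ‖(U * P).trace‖ ≤ P.trace.re := by
  obtain ⟨c, hc, hcz⟩ : ∃ c : ℂ, ‖c‖ = 1 ∧ c * (U * P).trace = ‖(U * P).trace‖ := by
    obtain ⟨d, hd, hdz⟩ := RCLike.exists_norm_mul_eq_self (K := ℂ) (U * P).trace
    have hd0 : d ≠ 0 := norm_ne_zero_iff.1 (by rw [hd]; exact one_ne_zero)
    refine ⟨d⁻¹, by rw [norm_inv, hd, inv_one], ?_⟩
    rw [inv_mul_eq_iff_eq_mul₀ hd0]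
    exact hdz.symm
  have hcU : c • U ∈ Matrix.unitaryGroup (Fin n) ℂ := by
    rw [Matrix.mem_unitaryGroup_iff', star_smul, smul_mul_smul_comm,
      Matrix.mem_unitaryGroup_iff'.1 hU]
    have : star c * c = 1 := by
      rw [Complex.star_def, Complex.conj_mul', hc]; simp
    rw [this, one_smul]
  have := re_trace_unitary_mul_le hcU hP
  rwa [smul_mul_assoc, Matrix.trace_smul, smul_eq_mul, hcz, Complex.ofReal_re] at this

/-- The average of the powers of `A`, which for `A ^ m = 1` projects onto the fixed vectors. -/
noncomputable def powAverage (A : Matrix (Fin n) (Fin n) ℂ) (m : ℕ) : Matrix (Fin n) (Fin n) ℂ :=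
  (m : ℂ)⁻¹ • ∑ j ∈ Finset.range m, A ^ j

lemma mul_powAverage {A : Matrix (Fin n) (Fin n) ℂ} {m : ℕ} (hA : A ^ m = 1) :
    A * powAverage A m = powAverage A m := by
  have h := Finset.sum_range_succ' (fun j => A ^ j) m
  rw [Finset.sum_range_succ, hA, pow_zero, add_left_inj] at h
  rw [powAverage, mul_smul_comm, Finset.mul_sum]
  simp only [← pow_succ', ← h]

lemma isStarProjection_powAverage {A : Matrix (Fin n) (Fin n) ℂ} {m : ℕ} (hm : m ≠ 0)
    (hU : A ∈ Matrix.unitaryGroup (Fin n) ℂ) (hA : A ^ m = 1) :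
    IsStarProjection (powAverage A m) := by
  have hm' : (m : ℂ) ≠ 0 := Nat.cast_ne_zero.2 hm
  have hpow : ∀ j, A ^ j * powAverage A m = powAverage A m := by
    intro j
    induction j with
    | zero => simp
    | succ j ih => rw [pow_succ, mul_assoc, mul_powAverage hA, ih]
  have hstar : ∀ j, star A ^ j * powAverage A m = powAverage A m := by
    intro j
    have h1 : star A ^ j * A ^ j = 1 := by
      rw [← star_pow]
      exact Matrix.mem_unitaryGroup_iff'.1 (pow_mem hU j)
    conv_lhs => rw [← hpow j]
    rw [← mul_assoc, h1, one_mul]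
  have havg : ∀ f : ℕ → Matrix (Fin n) (Fin n) ℂ,
      (∀ j, f j * powAverage A m = powAverage A m) →
      ((m : ℂ)⁻¹ • ∑ j ∈ Finset.range m, f j) * powAverage A m = powAverage A m := by
    intro f hf
    rw [smul_mul_assoc, Finset.sum_mul, Finset.sum_congr rfl fun j _ => hf j, Finset.sum_const,
      Finset.card_range, ← Nat.cast_smul_eq_nsmul ℂ, inv_smul_smul₀ hm']
  have hst : star (powAverage A m) = (m : ℂ)⁻¹ • ∑ j ∈ Finset.range m, star A ^ j := by
    simp [powAverage, star_smul, star_sum]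
  have hsp : star (powAverage A m) * powAverage A m = powAverage A m := by
    conv_lhs => rw [hst]
    exact havg _ hstar
  have hsa : star (powAverage A m) = powAverage A m := by
    conv_lhs => rw [← hsp, star_mul, star_star, hsp]
  exact ⟨havg _ hpow, hsa⟩

lemma trace_mul_powAverage {A B T : Matrix.unitaryGroup (Fin n) ℂ} {m : ℕ} (hm : m ≠ 0)
    (hAT : A * T = T * A) (h : T * B = A * (B * T)) :
    ((B : Matrix (Fin n) (Fin n) ℂ) * powAverage (A : Matrix (Fin n) (Fin n) ℂ) m).trace =
      (B : Matrix (Fin n) (Fin n) ℂ).trace := by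
  have hm' : (m : ℂ) ≠ 0 := Nat.cast_ne_zero.2 hm
  have hstep : ∀ j : ℕ, T ^ j * B = A ^ j * B * T ^ j := by
    intro j
    induction j with
    | zero => simp
    | succ j ih =>
      have hc : T * A ^ j = A ^ j * T := (Commute.pow_left hAT j).eq.symm
      rw [pow_succ', mul_assoc, ih, ← mul_assoc, ← mul_assoc, hc, mul_assoc (A ^ j), h]
      simp only [pow_succ, mul_assoc]
  have htr : ∀ j : ℕ, ((B : Matrix (Fin n) (Fin n) ℂ) * (A : Matrix (Fin n) (Fin n) ℂ) ^ j).trace =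
      (B : Matrix (Fin n) (Fin n) ℂ).trace := by
    intro j
    have e : A ^ j * B = T ^ j * (B * (T ^ j)⁻¹) := by
      rw [← mul_assoc, hstep, mul_inv_cancel_right]
    have e' := congrArg (fun U : Matrix.unitaryGroup (Fin n) ℂ =>
      (U : Matrix (Fin n) (Fin n) ℂ).trace) e
    simp only [Submonoid.coe_mul] at e'
    rw [Matrix.trace_mul_comm, ← SubmonoidClass.coe_pow, e', Matrix.trace_mul_comm, mul_assoc,
      ← Submonoid.coe_mul, inv_mul_cancel, Submonoid.coe_one, mul_one]
  rw [powAverage, mul_smul_comm, Finset.mul_sum, Matrix.trace_smul, Matrix.trace_sum,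
    Finset.sum_congr rfl fun j _ => htr j, Finset.sum_const, Finset.card_range, nsmul_eq_mul,
    smul_eq_mul, inv_mul_cancel_left₀ hm']

variable {p : ℕ}

lemma Gp_mul (x y : Gp p) :
    x * y = (x.1 + y.1 + x.2.2 • y.2.1, x.2.1 + y.2.1, x.2.2 + y.2.2) := rfl

/-- The inclusion of the central subgroup `ℤ[1/p]` in `G_p`. -/
def centralHom (p : ℕ) : Multiplicative (Zp p) →* Gp p where
  toFun a := (a.toAdd, 0, 0)
  map_one' := rfl
  map_mul' a b := by simp [Gp_mul]

lemma exists_pow_prime_nsmul_eq (hp : p.Prime) (a : Zp p) (s : ℕ) :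
    ∃ b : Zp p, p ^ s • b = a := by
  have hp0 : (p : ℚ) ≠ 0 := Nat.cast_ne_zero.2 hp.ne_zero
  obtain ⟨q, k, t, h⟩ := a
  refine ⟨⟨q / (p : ℚ) ^ s, k, t + s, ?_⟩, ?_⟩
  · rw [← h, pow_add]; field_simp
  · apply Subtype.ext
    simp only [AddSubgroup.coe_nsmul, nsmul_eq_mul]
    push_cast
    field_simp

lemma exists_pow_prime_nsmul_eq_zsmul_one (a : Zp p) :
    ∃ (k : ℤ) (t : ℕ), p ^ t • a = k • (⟨1, one_mem_Zp p⟩ : Zp p) := by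
  obtain ⟨q, k, t, h⟩ := a
  refine ⟨k, t, Subtype.ext ?_⟩
  simp [← h, mul_comm]

/-- A homomorphism from `ℤ[1/p]` whose image has finite exponent has image of exponent prime
to `p`. -/
lemma exists_coprime_exponent (hp : p.Prime) {G : Type*} [Group G]
    (φ : Multiplicative (Zp p) →* G) {N : ℕ} (hN : N ≠ 0) (h : ∀ a, φ a ^ N = 1) :
    ∃ m, m ≠ 0 ∧ p.Coprime m ∧ ∀ a, φ a ^ m = 1 := by
  obtain ⟨s, m, hpm, rfl⟩ := Nat.exists_eq_pow_mul_and_not_dvd hN p hp.ne_one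
  refine ⟨m, right_ne_zero_of_mul hN, (Nat.Prime.coprime_iff_not_dvd hp).2 hpm, fun a => ?_⟩
  obtain ⟨b, hb⟩ := exists_pow_prime_nsmul_eq hp a.toAdd s
  have : a = Multiplicative.ofAdd b ^ p ^ s := by
    rw [← ofAdd_nsmul, hb, ofAdd_toAdd]
  rw [this, map_pow, ← pow_mul, h]

lemma map_mem_zpowers (φ : Multiplicative (Zp p) →* Matrix.unitaryGroup (Fin n) ℂ) {m : ℕ}
    (hpm : p.Coprime m) (h : ∀ a, φ a ^ m = 1) (a : Multiplicative (Zp p)) :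
    φ a ∈ Subgroup.zpowers (φ (Multiplicative.ofAdd ⟨1, one_mem_Zp p⟩)) := by
  obtain ⟨k, t, hk⟩ := exists_pow_prime_nsmul_eq_zsmul_one a.toAdd
  have hpow : φ a ^ p ^ t = φ (Multiplicative.ofAdd ⟨1, one_mem_Zp p⟩) ^ k := by
    rw [← map_pow, ← map_zpow, ← ofAdd_zsmul, ← hk, ofAdd_nsmul, ofAdd_toAdd]
  have hcop : (p ^ t).Coprime (orderOf (φ a)) :=
    (hpm.pow_left t).coprime_dvd_right (orderOf_dvd_of_pow_eq_one (h a))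
  obtain ⟨q, hq⟩ := exists_pow_eq_self_of_coprime hcop
  rw [← hq, hpow]
  exact pow_mem (zpow_mem (Subgroup.mem_zpowers _) k) q

/-- The trace estimate behind the theorem: central elements have trace close to `n` as soon as
`(0, 1, 0)` does. -/
lemma norm_trace_sub_le (hp : p.Prime) (π : Gp p →* Matrix.unitaryGroup (Fin n) ℂ) (a : Zp p) :
    ‖(π (a, 0, 0) : Matrix (Fin n) (Fin n) ℂ).trace - n‖ ≤
      2 * (n - (π (0, ⟨1, one_mem_Zp p⟩, 0) : Matrix (Fin n) (Fin n) ℂ).trace.re) := by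
  have hAB : ∀ a b : Zp p, π (a, 0, 0) * π (0, b, 0) = π (0, b, 0) * π (a, 0, 0) := by
    intro a b; simp only [← map_mul, Gp_mul]; simp
  have hAT : ∀ a : Zp p, π (a, 0, 0) * π (0, 0, 1) = π (0, 0, 1) * π (a, 0, 0) := by
    intro a; simp only [← map_mul, Gp_mul]; simp
  have hTB : ∀ b : Zp p, π (0, 0, 1) * π (0, b, 0) = π (b, 0, 0) * (π (0, b, 0) * π (0, 0, 1)) := by
    intro b; simp only [← map_mul, Gp_mul]; simp
  obtain ⟨m, hm, hpm, hexp⟩ := exists_coprime_exponent hp (π.comp (centralHom p))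
    n.factorial_ne_zero fun b => unitary_pow_factorial_eq_one (hAB _ _) (hAT _) (hTB b.toAdd)
  set A := π (⟨1, one_mem_Zp p⟩, 0, 0)
  set P := powAverage (A : Matrix (Fin n) (Fin n) ℂ) m
  have hAm : (A : Matrix (Fin n) (Fin n) ℂ) ^ m = 1 :=
    congrArg Subtype.val (hexp (Multiplicative.ofAdd ⟨1, one_mem_Zp p⟩))
  have hP : IsStarProjection P := isStarProjection_powAverage hm A.2 hAm
  have hstab : Subgroup.zpowers A ≤
      MulAction.stabilizer (Matrix.unitaryGroup (Fin n) ℂ) P :=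
    Subgroup.zpowers_le.2 (mul_powAverage hAm)
  have haP : (π (a, 0, 0) : Matrix (Fin n) (Fin n) ℂ) * P = P :=
    hstab (map_mem_zpowers (π.comp (centralHom p)) hpm hexp (Multiplicative.ofAdd a))
  have hB := re_trace_unitary_mul_le (π (0, ⟨1, one_mem_Zp p⟩, 0)).2 hP
  rw [trace_mul_powAverage hm (hAT _) (hTB _)] at hB
  have hQ := norm_trace_unitary_mul_le (π (a, 0, 0)).2 hP.one_sub
  have hQ1 := norm_trace_unitary_mul_le (one_mem _) hP.one_sub
  have hdecomp : (π (a, 0, 0) : Matrix (Fin n) (Fin n) ℂ).trace - n =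
      ((π (a, 0, 0) : Matrix (Fin n) (Fin n) ℂ) * (1 - P)).trace - (1 * (1 - P)).trace := by
    rw [mul_sub, haP, mul_one, one_mul, Matrix.trace_sub, Matrix.trace_sub, Matrix.trace_one,
      Fintype.card_fin]
    ring
  have htr : (1 - P).trace.re = n - P.trace.re := by
    simp [Matrix.trace_sub]
  rw [hdecomp]
  refine (norm_sub_le _ _).trans ?_
  rw [htr] at hQ hQ1
  linarith

end HeisenbergTrace

/-- if `π_k : G_p → U(n_k)` are homomorphisms whose normalized traces at
`(0,1,0)` tend to `1`, then for every `a ∈ ℤ[1/p]` the normalized traces at `(a,0,0)`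
also tend to `1`. -/
theorem fd_traces_near_one (p : ℕ) (hp : p.Prime)
    (n : ℕ → ℕ) (hn : ∀ k, 0 < n k)
    (π : ∀ k, Gp p →* Matrix.unitaryGroup (Fin (n k)) ℂ)
    (h1 : Tendsto (fun k => trN (n k) (π k (0, ⟨1, one_mem_Zp p⟩, 0))) atTop (nhds 1)) :
    ∀ a : Zp p, Tendsto (fun k => trN (n k) (π k (a, 0, 0))) atTop (nhds 1) := by
  intro a
  have hlim : Tendsto (fun k => 2 * (1 -
      (trN (n k) (π k (0, ⟨1, one_mem_Zp p⟩, 0))).re)) atTop (nhds 0) := by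
    simpa using ((Complex.continuous_re.tendsto _).comp h1).const_sub 1 |>.const_mul 2
  rw [tendsto_iff_norm_sub_tendsto_zero]
  refine squeeze_zero (fun _ => norm_nonneg _) (fun k => ?_) hlim
  have hk : (0 : ℝ) < n k := Nat.cast_pos.2 (hn k)
  have hk' : (n k : ℂ) ≠ 0 := Nat.cast_ne_zero.2 (hn k).ne'
  have h := HeisenbergTrace.norm_trace_sub_le hp (π k) a
  rw [trN, trN, div_sub_one hk', norm_div, Complex.norm_natCast, Complex.div_natCast_re,
    div_le_iff₀ hk]
  refine h.trans_eq ?_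
  field_simp
end

section
/- For every prime p, the group G_p is not Hilbert–Schmidt stable: there exist a sequence of positive integers (n_k) and functions π_k : G_p → U(n_k) with lim_k ‖π_k(gh) − π_k(g)π_k(h)‖₂ = 0 for all g, h ∈ G_p, such that for every sequence of group homomorphisms σ_k : G_p → U(n_k) there is some g ∈ G_p with ‖π_k(g) − σ_k(g)‖₂ not converging to 0. -/
open Filter Topology Matrix

/-- The normalized Hilbert–Schmidt norm `‖A‖₂ = (Tr_n(A*A))^{1/2}` of an `n × n`
complex matrix, where `Tr_n` is the normalized trace. -/
noncomputable def hsNorm (n : ℕ) (A : Matrix (Fin n) (Fin n) ℂ) : ℝ :=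
  Real.sqrt ((Aᴴ * A).trace.re / n)

open scoped Fin.CommRing in
lemma exists_val_add_intCast {N : ℕ} [NeZero N] (x : Fin N) (c : ℤ) :
    ∃ k : ℤ, (((x + (c : Fin N) : Fin N) : ℕ) : ℤ) = (x : ℕ) + c + N * k := by
  have hN : (N : ℤ) ≠ 0 := by exact_mod_cast NeZero.ne N
  have h : (N : ℤ) ∣ (((x + (c : Fin N) : Fin N) : ℕ) : ℤ) - ((x : ℕ) + c) := by
    rw [Fin.val_add, Fin.val_intCast]
    push_cast
    rw [Int.toNat_of_nonneg (Int.emod_nonneg _ hN)]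
    rw [Int.add_emod_emod]
    exact (Int.modEq_iff_dvd.1 (Int.mod_modEq _ _).symm)
  obtain ⟨k, hk⟩ := h
  exact ⟨k, by linarith⟩

/-- The character `q ↦ exp (2πiq)` of the additive group of rationals. -/
noncomputable def ratPhase (q : ℚ) : ℂ := Complex.exp (2 * Real.pi * Complex.I * q)

lemma ratPhase_add (a b : ℚ) : ratPhase (a + b) = ratPhase a * ratPhase b := by
  rw [ratPhase, ratPhase, ratPhase, ← Complex.exp_add]
  push_cast
  ring_nf

lemma ratPhase_intCast (k : ℤ) : ratPhase k = 1 := by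
  rw [ratPhase, Complex.exp_eq_one_iff]
  exact ⟨k, by push_cast; ring⟩

lemma ratPhase_mul_conj (a : ℚ) : ratPhase a * starRingEnd ℂ (ratPhase a) = 1 := by
  have h : ‖ratPhase a‖ = 1 := by
    rw [ratPhase, show (2 * Real.pi * Complex.I * a : ℂ) = ((2 * Real.pi * a : ℝ) : ℂ) * Complex.I by
      push_cast; ring]
    exact Complex.norm_exp_ofReal_mul_I _
  rw [Complex.mul_conj, Complex.normSq_eq_norm_sq, h]
  norm_num

lemma ratPhase_inv_natCast_ne_one {p : ℕ} (hp : 1 < p) : ratPhase (p : ℚ)⁻¹ ≠ 1 := by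
  rw [ratPhase]
  push_cast
  rw [← div_eq_mul_inv]
  exact (Complex.isPrimitiveRoot_exp p (by lia)).ne_one hp

open scoped Fin.CommRing in
/-- The Heisenberg-type matrix: multiplication by the character `x ↦ exp (2πi(a + bx))`
composed with translation by `c` on `ℤ/N`. -/
noncomputable def heisenbergMatrix (N : ℕ) [NeZero N] (a b : ℚ) (c : ℤ) :
    Matrix (Fin N) (Fin N) ℂ :=
  Matrix.of fun x y => if y = x + (c : Fin N) then ratPhase (a + b * (x : ℕ)) else 0

lemma heisenbergMatrix_mem_unitaryGroup (N : ℕ) [NeZero N] (a b : ℚ) (c : ℤ) :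
    heisenbergMatrix N a b c ∈ Matrix.unitaryGroup (Fin N) ℂ := by
  rw [Matrix.mem_unitaryGroup_iff]
  ext x z
  rw [Matrix.mul_apply, Matrix.one_apply]
  by_cases h : x = z
  · subst h
    simp [heisenbergMatrix, Matrix.star_apply, ratPhase_mul_conj]
  · simp [heisenbergMatrix, Matrix.star_apply, h]

lemma heisenbergMatrix_mul {N : ℕ} [NeZero N] (a₁ b₁ : ℚ) (c₁ : ℤ) (a₂ b₂ : ℚ) (c₂ : ℤ)
    {m : ℤ} (hm : b₂ * N = m) :
    heisenbergMatrix N a₁ b₁ c₁ * heisenbergMatrix N a₂ b₂ c₂ =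
      heisenbergMatrix N (a₁ + a₂ + c₁ * b₂) (b₁ + b₂) (c₁ + c₂) := by
  ext x z
  obtain ⟨k, hk⟩ := exists_val_add_intCast x c₁
  rw [Matrix.mul_apply]
  simp only [heisenbergMatrix, Matrix.of_apply, ite_mul, zero_mul, Finset.sum_ite_eq',
    Finset.mem_univ, if_true]
  simp only [mul_ite, mul_zero, Int.cast_add, ← add_assoc]
  refine if_congr Iff.rfl ?_ rfl
  have hk' := congrArg (Int.cast : ℤ → ℚ) hk
  push_cast at hk'
  rw [← ratPhase_add, hk', show a₁ + b₁ * (x : ℕ) + (a₂ + b₂ * ((x : ℕ) + c₁ + N * k)) =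
    (a₁ + a₂ + c₁ * b₂ + (b₁ + b₂) * (x : ℕ)) + ((m * k : ℤ) : ℚ) by
      push_cast; rw [← hm]; ring, ratPhase_add _ ((m * k : ℤ) : ℚ), ratPhase_intCast, mul_one]

lemma heisenbergMatrix_central (N : ℕ) [NeZero N] (a : ℚ) :
    heisenbergMatrix N a 0 0 = ratPhase a • (1 : Matrix (Fin N) (Fin N) ℂ) := by
  ext x y
  simp [heisenbergMatrix, Matrix.one_apply, eq_comm]

lemma heisenbergMatrix_zero_one_zero (N : ℕ) [NeZero N] : heisenbergMatrix N 0 1 0 = 1 := by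
  ext x y
  have h := ratPhase_intCast (x : ℕ)
  push_cast at h
  simp [heisenbergMatrix, Matrix.one_apply, eq_comm, h]

section HilbertSchmidt

lemma trace_conjTranspose_mul_self_re (n : ℕ) (A : Matrix (Fin n) (Fin n) ℂ) :
    (Aᴴ * A).trace.re = ∑ i, ∑ j, ‖A i j‖ ^ 2 := by
  rw [Finset.sum_comm]
  simp only [Matrix.trace, Matrix.diag, Matrix.mul_apply, Matrix.conjTranspose_apply,
    Complex.re_sum]
  refine Finset.sum_congr rfl fun j _ => Finset.sum_congr rfl fun i _ => ?_
  rw [← starRingEnd_apply, mul_comm, Complex.mul_conj, Complex.normSq_eq_norm_sq]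
  exact Complex.ofReal_re _

/-- Cauchy–Schwarz: pairing with a unitary is bounded by the Hilbert–Schmidt norm. -/
lemma norm_trace_unitary_mul_le {n : ℕ} (U : Matrix.unitaryGroup (Fin n) ℂ)
    (A : Matrix (Fin n) (Fin n) ℂ) :
    ‖((U : Matrix (Fin n) (Fin n) ℂ) * A).trace‖ ≤ n * hsNorm n A := by
  set B : Matrix (Fin n) (Fin n) ℂ := U.1
  have hB : ∑ i, ∑ j, ‖B i j‖ ^ 2 = n := by
    rw [← trace_conjTranspose_mul_self_re, ← Matrix.star_eq_conjTranspose,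
      Matrix.mem_unitaryGroup_iff'.1 U.2]
    simp
  have hA := trace_conjTranspose_mul_self_re n A
  have h₁ : ‖(B * A).trace‖ ≤ ∑ x : Fin n × Fin n, ‖B x.1 x.2‖ * ‖A x.2 x.1‖ := by
    rw [Fintype.sum_prod_type]
    simp only [Matrix.trace, Matrix.diag, Matrix.mul_apply]
    refine (norm_sum_le _ _).trans (Finset.sum_le_sum fun i _ => (norm_sum_le _ _).trans ?_)
    simp
  have h₂ := Finset.sum_mul_sq_le_sq_mul_sq Finset.univ
    (fun x : Fin n × Fin n => ‖B x.1 x.2‖) (fun x => ‖A x.2 x.1‖)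
  rw [Fintype.sum_prod_type (f := fun x : Fin n × Fin n => ‖B x.1 x.2‖ ^ 2),
    Fintype.sum_prod_type_right (f := fun x : Fin n × Fin n => ‖A x.2 x.1‖ ^ 2), hB, ← hA] at h₂
  have hA0 : 0 ≤ (Aᴴ * A).trace.re := by rw [hA]; positivity
  refine h₁.trans (abs_le_of_sq_le_sq' (b := n * hsNorm n A) (h₂.trans (le_of_eq ?_))
    (mul_nonneg n.cast_nonneg (Real.sqrt_nonneg _))).2
  rw [mul_pow, hsNorm, Real.sq_sqrt (by positivity)]
  rcases eq_or_ne (n : ℝ) 0 with h | h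
  · simp [h]
  · field_simp

lemma norm_trace_le {n : ℕ} (A : Matrix (Fin n) (Fin n) ℂ) : ‖A.trace‖ ≤ n * hsNorm n A := by
  simpa using norm_trace_unitary_mul_le 1 A

/-- If `tr (BY) = tr B` for unitaries `B` near `1` and `Y` near the scalar `η`, then `η` is
near `1`. -/
lemma norm_sub_one_le_of_trace_mul_eq {n : ℕ} (hn : 0 < n) {η : ℂ}
    (B Y : Matrix.unitaryGroup (Fin n) ℂ)
    (h : (B.1 * Y.1).trace = B.1.trace) :
    ‖η - 1‖ ≤ ‖η - 1‖ * hsNorm n (1 - B.1) + hsNorm n (η • 1 - Y.1) := by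
  have hn' : (0 : ℝ) < n := by exact_mod_cast hn
  have key : (n : ℂ) * (η - 1) =
      (η - 1) * (1 - B.1).trace + (B.1 * (η • 1 - Y.1)).trace := by
    rw [Matrix.mul_sub, Matrix.trace_sub, Matrix.trace_sub, h]
    simp
    ring
  have h₁ := congrArg norm key
  rw [norm_mul, Complex.norm_natCast] at h₁
  refine le_of_mul_le_mul_left ?_ hn'
  calc (n : ℝ) * ‖η - 1‖
      ≤ ‖η - 1‖ * ‖(1 - B.1).trace‖ + ‖(B.1 * (η • 1 - Y.1)).trace‖ := by
        rw [h₁, ← norm_mul]; exact norm_add_le _ _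
    _ ≤ ‖η - 1‖ * (n * hsNorm n (1 - B.1)) + n * hsNorm n (η • 1 - Y.1) :=
        add_le_add (mul_le_mul_of_nonneg_left (norm_trace_le _) (norm_nonneg _))
          (norm_trace_unitary_mul_le B _)
    _ = _ := by ring

end HilbertSchmidt

section CentralCommutator

lemma Module.End.pow_finrank_eigenspace_eq_one {V : Type*} [AddCommGroup V]
    [Module ℂ V] [FiniteDimensional ℂ V] {y b t : Module.End ℂ V} (hb : IsUnit b) (ht : IsUnit t)
    (hyb : Commute y b) (hyt : Commute y t) (h : t * b = y * b * t) (θ : ℂ) :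
    θ ^ Module.finrank ℂ (y.eigenspace θ) = 1 := by
  set E := y.eigenspace θ
  have hbE : Set.MapsTo b E E := Module.End.mapsTo_genEigenspace_of_comm hyb θ 1
  have htE : Set.MapsTo t E E := Module.End.mapsTo_genEigenspace_of_comm hyt θ 1
  have key : t.restrict htE * b.restrict hbE = θ • (b.restrict hbE * t.restrict htE) := by
    ext v
    have hv : y (b (t v)) = θ • b (t v) :=
      Module.End.mem_eigenspace_iff.1 (hbE (htE v.2))
    exact (LinearMap.congr_fun h (v : V)).trans hv
  have unit_restrict {f : Module.End ℂ V} (hf : IsUnit f) (hfE : Set.MapsTo f E E) :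
      LinearMap.det (f.restrict hfE) ≠ 0 := by
    refine (LinearMap.isUnit_iff_isUnit_det _).1 ?_ |>.ne_zero
    rw [LinearMap.isUnit_iff_ker_eq_bot, LinearMap.ker_eq_bot]
    intro v w hvw
    exact Subtype.ext (((Module.End.isUnit_iff _).1 hf).1 (congrArg Subtype.val hvw))
  have hdet := congrArg LinearMap.det key
  rw [LinearMap.det_smul, map_mul, map_mul, mul_comm (LinearMap.det (b.restrict hbE))] at hdet
  exact mul_right_cancel₀ (mul_ne_zero (unit_restrict ht htE) (unit_restrict hb hbE))
    (by rw [one_mul]; exact hdet.symm)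

open scoped Matrix.Norms.L2Operator in
/-- A unitary matrix which is a central commutator of unitary matrices has order dividing `n!`. -/
lemma unitaryGroup_pow_factorial_eq_one {n : ℕ} {y b t : Matrix.unitaryGroup (Fin n) ℂ}
    (hyb : Commute y b) (hyt : Commute y t) (h : t * b = y * b * t) :
    y ^ n.factorial = 1 := by
  apply Subtype.ext
  have hnormal : IsStarNormal ((y ^ n.factorial : Matrix.unitaryGroup (Fin n) ℂ) :
      Matrix (Fin n) (Fin n) ℂ) :=
    ⟨(Matrix.mem_unitaryGroup_iff'.1 (y ^ n.factorial).2).trans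
      (Matrix.mem_unitaryGroup_iff.1 (y ^ n.factorial).2).symm⟩
  refine CFC.eq_one_of_spectrum_subset_one (R := ℂ) (p := IsStarNormal) _ ?_ hnormal
  let φ : Matrix.unitaryGroup (Fin n) ℂ →* Module.End ℂ (Fin n → ℂ) :=
    (Matrix.toLinAlgEquiv' : Matrix (Fin n) (Fin n) ℂ ≃ₐ[ℂ] _).toAlgHom.toMonoidHom.comp
      (Submonoid.subtype _)
  rw [SubmonoidClass.coe_pow, spectrum.map_pow_of_pos _ n.factorial_pos]
  rintro _ ⟨θ, hθ, rfl⟩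
  have hθ' : (φ y).HasEigenvalue θ := by
    rw [Module.End.hasEigenvalue_iff_mem_spectrum]
    exact (AlgEquiv.spectrum_eq
      (Matrix.toLinAlgEquiv' : Matrix (Fin n) (Fin n) ℂ ≃ₐ[ℂ] _) y.1).symm ▸ hθ
  have hpow := Module.End.pow_finrank_eigenspace_eq_one
    ((Group.isUnit b).map φ) ((Group.isUnit t).map φ) (hyb.map φ) (hyt.map φ)
    (by rw [← map_mul, h, map_mul, map_mul]) θ
  have hpos : 0 < Module.finrank ℂ ((φ y).eigenspace θ) :=
    Module.finrank_pos_iff.2 (Submodule.nontrivial_iff_ne_bot.2 hθ')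
  have hle : Module.finrank ℂ ((φ y).eigenspace θ) ≤ n := by
    simpa using Submodule.finrank_le ((φ y).eigenspace θ)
  obtain ⟨k, hk⟩ := Nat.dvd_factorial hpos hle
  show θ ^ n.factorial = 1
  rw [hk, pow_mul, hpow, one_pow]

end CentralCommutator

namespace Gp

variable {p : ℕ}

lemma mul_def_s10 (x y : Gp p) :
    x * y = (x.1 + y.1 + x.2.2 • y.2.1, x.2.1 + y.2.1, x.2.2 + y.2.2) := rfl

/-- The central copy of `ℤ[1/p]` in `Gp p`. -/
def central (p : ℕ) : Multiplicative (Zp p) →* Gp p where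
  toFun x := (x.toAdd, 0, 0)
  map_one' := rfl
  map_mul' x y := by simp [mul_def_s10]

lemma central_commute (x : Multiplicative (Zp p)) (g : Gp p) : Commute (central p x) g := by
  simp [Commute, SemiconjBy, central, mul_def_s10, add_comm]

lemma translation_mul (b : Zp p) (c : ℤ) :
    ((0, 0, c) : Gp p) * (0, b, 0) =
      central p (Multiplicative.ofAdd (c • b)) * (0, b, 0) * (0, 0, c) := by
  simp [central, mul_def_s10]

end Gp

/-- The element `1 / p ^ n` of `ℤ[1/p]`. -/
def Zp.invPow {p : ℕ} (hp : p ≠ 0) (n : ℕ) : Zp p :=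
  ⟨((p : ℚ) ^ n)⁻¹, 1, n, by
    rw [inv_mul_cancel₀ (pow_ne_zero _ (Nat.cast_ne_zero.2 hp)), Int.cast_one]⟩

namespace Gp

variable {p n : ℕ}

lemma map_central_pow_factorial (σ : Gp p →* Matrix.unitaryGroup (Fin n) ℂ) (x : Zp p) :
    σ (central p (Multiplicative.ofAdd x)) ^ n.factorial = 1 := by
  refine unitaryGroup_pow_factorial_eq_one (b := σ (0, x, 0)) (t := σ (0, 0, 1))
    ((central_commute _ _).map σ) ((central_commute _ _).map σ) ?_
  simpa using congrArg σ (translation_mul x 1)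

/-- In a finite-dimensional unitary representation, the image of the central `ℤ[1/p]` is the
image of `ℤ`. -/
lemma exists_map_central_invPow_one (hp : p.Prime) (σ : Gp p →* Matrix.unitaryGroup (Fin n) ℂ) :
    ∃ j : ℤ, σ (central p (Multiplicative.ofAdd (Zp.invPow hp.ne_zero 1))) =
      σ (central p (Multiplicative.ofAdd (j • (⟨1, one_mem_Zp p⟩ : Zp p)))) := by
  obtain ⟨a, m, hm, hfac⟩ := Nat.exists_eq_pow_mul_and_not_dvd n.factorial_ne_zero p hp.ne_one
  obtain ⟨u, v, huv⟩ := Nat.isCoprime_iff_coprime.2 ((Nat.Prime.coprime_iff_not_dvd hp).2 hm)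
  have hp0 : (p : ℚ) ≠ 0 := Nat.cast_ne_zero.2 hp.ne_zero
  have key : Zp.invPow hp.ne_zero 1 = u • (⟨1, one_mem_Zp p⟩ : Zp p) +
      v • (n.factorial • Zp.invPow hp.ne_zero (a + 1)) := by
    apply Subtype.ext
    have huv' := congrArg (Int.cast : ℤ → ℚ) huv
    push_cast at huv'
    simp only [Zp.invPow, AddSubgroup.coe_add, AddSubgroup.coe_zsmul, AddSubgroup.coe_nsmul,
      zsmul_eq_mul, nsmul_eq_mul, hfac]
    push_cast
    field_simp
    linear_combination -((p : ℚ) ^ (a + 1)) * huv'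
  refine ⟨u, ?_⟩
  rw [key, ofAdd_add, map_mul, map_mul, ofAdd_zsmul v, ofAdd_nsmul, map_zpow, map_zpow, map_pow,
    map_pow, map_central_pow_factorial, _root_.one_zpow, mul_one]

lemma trace_map_mul_central_invPow_one (hp : p.Prime)
    (σ : Gp p →* Matrix.unitaryGroup (Fin n) ℂ) :
    ((σ (0, ⟨1, one_mem_Zp p⟩, 0)).1 *
      (σ (central p (Multiplicative.ofAdd (Zp.invPow hp.ne_zero 1)))).1).trace =
      (σ (0, ⟨1, one_mem_Zp p⟩, 0)).1.trace := by
  obtain ⟨j, hj⟩ := exists_map_central_invPow_one hp σ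
  rw [hj, Matrix.trace_mul_comm]
  have h : central p (Multiplicative.ofAdd (j • (⟨1, one_mem_Zp p⟩ : Zp p))) *
      (0, ⟨1, one_mem_Zp p⟩, 0) = (0, 0, j) * (0, ⟨1, one_mem_Zp p⟩, 0) * (0, 0, j)⁻¹ :=
    eq_mul_inv_of_mul_eq (translation_mul _ _).symm
  have h' := congrArg (fun g => (σ g).1.trace) h
  simp only [map_mul] at h'
  refine h'.trans ?_
  show ((σ (0, 0, j)).1 * _ * (σ (0, 0, j)⁻¹).1).trace = _
  rw [Matrix.trace_mul_comm, ← mul_assoc]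
  have h₁ : (σ (0, 0, j)⁻¹).1 * (σ (0, 0, j)).1 = 1 :=
    congrArg Subtype.val (show σ (0, 0, j)⁻¹ * σ (0, 0, j) = 1 by
      rw [← map_mul, inv_mul_cancel, map_one])
  rw [h₁, one_mul]

end Gp

/-- `G_p` is not Hilbert–Schmidt stable: there is a sequence of unitary
almost-homomorphisms (in the normalized HS norm) that stays uniformly away from every
sequence of true unitary representations. -/
theorem Gp_not_HS_stable (p : ℕ) (hp : p.Prime) :
    ∃ (n : ℕ → ℕ), (∀ k, 0 < n k) ∧
      ∃ π : ∀ k, Gp p → Matrix.unitaryGroup (Fin (n k)) ℂ,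
        (∀ g h : Gp p,
          Tendsto (fun k =>
            hsNorm (n k) ((π k (g * h) : Matrix (Fin (n k)) (Fin (n k)) ℂ) -
              (π k g : Matrix (Fin (n k)) (Fin (n k)) ℂ) *
                (π k h : Matrix (Fin (n k)) (Fin (n k)) ℂ))) atTop (nhds 0)) ∧
        ∀ σ : ∀ k, Gp p →* Matrix.unitaryGroup (Fin (n k)) ℂ,
          ∃ g : Gp p,
            ¬ Tendsto (fun k =>
                hsNorm (n k) ((π k g : Matrix (Fin (n k)) (Fin (n k)) ℂ) -
                  (σ k g : Matrix (Fin (n k)) (Fin (n k)) ℂ))) atTop (nhds 0) := by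
  have hp0 : ∀ k, NeZero (p ^ k) := fun k => ⟨pow_ne_zero k hp.ne_zero⟩
  refine ⟨fun k => p ^ k, fun k => pow_pos hp.pos k, fun k g =>
    ⟨heisenbergMatrix (p ^ k) g.1 g.2.1 g.2.2, heisenbergMatrix_mem_unitaryGroup _ _ _ _⟩, ?_, ?_⟩
  · intro g h
    obtain ⟨m, n, hmn⟩ := h.2.1.2
    refine tendsto_const_nhds.congr' ?_
    filter_upwards [eventually_ge_atTop n] with k hk
    have hb : ((h.2.1 : Zp p) : ℚ) * ((p ^ k : ℕ) : ℚ) = ((m * (p : ℤ) ^ (k - n) : ℤ) : ℚ) := by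
      push_cast
      rw [← hmn, mul_assoc, ← pow_add, Nat.add_sub_cancel' hk]
    rw [heisenbergMatrix_mul _ _ _ _ _ _ hb, Gp.mul_def_s10]
    simp [hsNorm]
  · intro σ
    by_contra! hσ
    have hB := hσ (0, ⟨1, one_mem_Zp p⟩, 0)
    have hY := hσ (Gp.central p (Multiplicative.ofAdd (Zp.invPow hp.ne_zero 1)))
    have hlim := (hB.const_mul ‖ratPhase (p : ℚ)⁻¹ - 1‖).add hY
    rw [mul_zero, add_zero] at hlim
    have hle : ‖ratPhase (p : ℚ)⁻¹ - 1‖ ≤ 0 := by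
      refine ge_of_tendsto' hlim fun k => ?_
      refine (norm_sub_one_le_of_trace_mul_eq (pow_pos hp.pos k) _ _
        (Gp.trace_map_mul_central_invPow_one hp (σ k))).trans (le_of_eq ?_)
      simp [Gp.central, Zp.invPow, heisenbergMatrix_central, heisenbergMatrix_zero_one_zero]
    exact ratPhase_inv_natCast_ne_one hp.one_lt (sub_eq_zero.1 (norm_le_zero_iff.1 hle))
end

section
/- For every prime p, the group G̃_p is finitely presented: there exist a finite set S and a finite set R of words in S such that G̃_p is isomorphic to the group presented by generators S and relators R. -/
lemma Zp.mul_mem {p : ℕ} {a b : ℚ} (ha : a ∈ Zp p) (hb : b ∈ Zp p) : a * b ∈ Zp p := by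
  obtain ⟨k1, n1, h1⟩ := ha
  obtain ⟨k2, n2, h2⟩ := hb
  refine ⟨k1 * k2, n1 + n2, ?_⟩
  push_cast
  calc a * b * (p : ℚ) ^ (n1 + n2) = (a * (p : ℚ) ^ n1) * (b * (p : ℚ) ^ n2) := by
        rw [pow_add]; ring
    _ = (k1 : ℚ) * (k2 : ℚ) := by rw [h1, h2]

lemma Zp.intCast_mem (p : ℕ) (k : ℤ) : (k : ℚ) ∈ Zp p := ⟨k, 0, by norm_num⟩

lemma Zp.zpow_mem {p : ℕ} (hp : (p : ℚ) ≠ 0) (n : ℤ) : (p : ℚ) ^ n ∈ Zp p := by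
  rcases n with k | k
  · refine ⟨(p : ℤ) ^ k, 0, ?_⟩
    push_cast
    simp
  · refine ⟨1, k + 1, ?_⟩
    rw [zpow_negSucc]
    push_cast
    rw [inv_mul_cancel₀ (pow_ne_zero _ hp)]

/-- Membership predicate for the group `G̃_p`: upper triangular `5 × 5` matrices with
rows `(1, x₁₂, x₁₃, x₁₄, x₁₅)`, `(0, pⁿ, x₂₃, x₂₄, x₂₅)`, `(0, 0, pᵏ, x₃₄, x₃₅)`,
`(0,0,0,1,m)`, `(0,0,0,0,1)` where the `xᵢⱼ ∈ ℤ[1/p]`, `k, n, m ∈ ℤ`. -/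
def GtPred (p : ℕ) (M : Matrix (Fin 5) (Fin 5) ℚ) : Prop :=
  (∃ n : ℤ, M 1 1 = (p : ℚ) ^ n) ∧ (∃ k : ℤ, M 2 2 = (p : ℚ) ^ k) ∧
  (∃ m : ℤ, M 3 4 = (m : ℚ)) ∧
  M 0 0 = 1 ∧ M 3 3 = 1 ∧ M 4 4 = 1 ∧
  M 0 1 ∈ Zp p ∧ M 0 2 ∈ Zp p ∧ M 0 3 ∈ Zp p ∧ M 0 4 ∈ Zp p ∧
  M 1 2 ∈ Zp p ∧ M 1 3 ∈ Zp p ∧ M 1 4 ∈ Zp p ∧ M 2 3 ∈ Zp p ∧ M 2 4 ∈ Zp p ∧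
  M 1 0 = 0 ∧ M 2 0 = 0 ∧ M 2 1 = 0 ∧
  M 3 0 = 0 ∧ M 3 1 = 0 ∧ M 3 2 = 0 ∧
  M 4 0 = 0 ∧ M 4 1 = 0 ∧ M 4 2 = 0 ∧ M 4 3 = 0

set_option maxHeartbeats 2000000 in
/-- The group `G̃_p`, as a subgroup of the units of the `5 × 5` matrices over `ℚ`. -/
def Gt (p : ℕ) (hp : p.Prime) : Subgroup (Matrix (Fin 5) (Fin 5) ℚ)ˣ where
  carrier := {M | GtPred p M.val}
  one_mem' := by
    refine ⟨⟨0, ?_⟩, ⟨0, ?_⟩, ⟨0, ?_⟩, ?_, ?_, ?_, ?_, ?_, ?_, ?_, ?_, ?_, ?_, ?_, ?_,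
      ?_, ?_, ?_, ?_, ?_, ?_, ?_, ?_, ?_, ?_⟩ <;>
      simp [Matrix.one_apply, (Zp p).zero_mem]
  mul_mem' := by
    have hp0 : (p : ℚ) ≠ 0 := Nat.cast_ne_zero.mpr hp.ne_zero
    rintro A B ⟨⟨na, a11⟩, ⟨ka, a22⟩, ⟨ma, a34⟩, a00, a33, a44,
      a01, a02, a03, a04, a12, a13, a14, a23, a24,
      a10, a20, a21, a30, a31, a32, a40, a41, a42, a43⟩
      ⟨⟨nb, b11⟩, ⟨kb, b22⟩, ⟨mb, b34⟩, b00, b33, b44,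
      b01, b02, b03, b04, b12, b13, b14, b23, b24,
      b10, b20, b21, b30, b31, b32, b40, b41, b42, b43⟩
    have e : ∀ i j, (A.val * B.val) i j =
        A.val i 0 * B.val 0 j + A.val i 1 * B.val 1 j + A.val i 2 * B.val 2 j +
          A.val i 3 * B.val 3 j + A.val i 4 * B.val 4 j := by
      intro i j
      rw [Matrix.mul_apply, Fin.sum_univ_five]
    refine ⟨⟨na + nb, ?_⟩, ⟨ka + kb, ?_⟩, ⟨ma + mb, ?_⟩, ?_, ?_, ?_, ?_, ?_, ?_, ?_, ?_,
      ?_, ?_, ?_, ?_, ?_, ?_, ?_, ?_, ?_, ?_, ?_, ?_, ?_, ?_⟩ <;>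
      simp only [Units.val_mul, e, a11, a22, a34, a00, a33, a44,
        a10, a20, a21, a30, a31, a32, a40, a41, a42, a43,
        b11, b22, b34, b00, b33, b44,
        b10, b20, b21, b30, b31, b32, b40, b41, b42, b43,
        one_mul, mul_one, mul_zero, zero_mul, add_zero, zero_add]
    · exact (zpow_add₀ hp0 na nb).symm
    · exact (zpow_add₀ hp0 ka kb).symm
    · push_cast; ring
    · exact (Zp p).add_mem b01 (Zp.mul_mem a01 (Zp.zpow_mem hp0 nb))
    · exact (Zp p).add_mem ((Zp p).add_mem b02 (Zp.mul_mem a01 b12))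
        (Zp.mul_mem a02 (Zp.zpow_mem hp0 kb))
    · exact (Zp p).add_mem ((Zp p).add_mem ((Zp p).add_mem b03 (Zp.mul_mem a01 b13))
        (Zp.mul_mem a02 b23)) a03
    · exact (Zp p).add_mem ((Zp p).add_mem ((Zp p).add_mem ((Zp p).add_mem b04
        (Zp.mul_mem a01 b14)) (Zp.mul_mem a02 b24))
        (Zp.mul_mem a03 (Zp.intCast_mem p mb))) a04
    · exact (Zp p).add_mem (Zp.mul_mem (Zp.zpow_mem hp0 na) b12)
        (Zp.mul_mem a12 (Zp.zpow_mem hp0 kb))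
    · exact (Zp p).add_mem ((Zp p).add_mem (Zp.mul_mem (Zp.zpow_mem hp0 na) b13)
        (Zp.mul_mem a12 b23)) a13
    · exact (Zp p).add_mem ((Zp p).add_mem ((Zp p).add_mem
        (Zp.mul_mem (Zp.zpow_mem hp0 na) b14) (Zp.mul_mem a12 b24))
        (Zp.mul_mem a13 (Zp.intCast_mem p mb))) a14
    · exact (Zp p).add_mem (Zp.mul_mem (Zp.zpow_mem hp0 ka) b23) a23
    · exact (Zp p).add_mem ((Zp p).add_mem (Zp.mul_mem (Zp.zpow_mem hp0 ka) b24)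
        (Zp.mul_mem a23 (Zp.intCast_mem p mb))) a24
  inv_mem' := by
    have hp0 : (p : ℚ) ≠ 0 := Nat.cast_ne_zero.mpr hp.ne_zero
    rintro A ⟨⟨na, a11⟩, ⟨ka, a22⟩, ⟨ma, a34⟩, a00, a33, a44,
      a01, a02, a03, a04, a12, a13, a14, a23, a24,
      a10, a20, a21, a30, a31, a32, a40, a41, a42, a43⟩
    have hu : A.val 1 1 ≠ 0 := by rw [a11]; exact zpow_ne_zero _ hp0
    have hv : A.val 2 2 ≠ 0 := by rw [a22]; exact zpow_ne_zero _ hp0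
    have hiu : (A.val 1 1)⁻¹ ∈ Zp p := by
      rw [a11, ← zpow_neg]; exact Zp.zpow_mem hp0 (-na)
    have hiv : (A.val 2 2)⁻¹ ∈ Zp p := by
      rw [a22, ← zpow_neg]; exact Zp.zpow_mem hp0 (-ka)
    have hm : A.val 3 4 ∈ Zp p := by rw [a34]; exact Zp.intCast_mem p ma
    have hinv : (A⁻¹).val =
        !![1,
           -(A.val 0 1) * (A.val 1 1)⁻¹,
           A.val 0 1 * A.val 1 2 * (A.val 1 1)⁻¹ * (A.val 2 2)⁻¹ -
             A.val 0 2 * (A.val 2 2)⁻¹,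
           -(A.val 0 1) * (A.val 1 2 * A.val 2 3 * (A.val 2 2)⁻¹ - A.val 1 3) *
               (A.val 1 1)⁻¹ + A.val 0 2 * A.val 2 3 * (A.val 2 2)⁻¹ - A.val 0 3,
           A.val 0 1 * (A.val 1 2 * (A.val 2 3 * A.val 3 4 - A.val 2 4) * (A.val 2 2)⁻¹ -
               A.val 1 3 * A.val 3 4 + A.val 1 4) * (A.val 1 1)⁻¹ -
             A.val 0 2 * (A.val 2 3 * A.val 3 4 - A.val 2 4) * (A.val 2 2)⁻¹ +
             A.val 0 3 * A.val 3 4 - A.val 0 4;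
           0, (A.val 1 1)⁻¹,
           -(A.val 1 2) * (A.val 2 2)⁻¹ * (A.val 1 1)⁻¹,
           (A.val 1 2 * A.val 2 3 * (A.val 2 2)⁻¹ - A.val 1 3) * (A.val 1 1)⁻¹,
           -(A.val 1 2 * (A.val 2 3 * A.val 3 4 - A.val 2 4) * (A.val 2 2)⁻¹ -
               A.val 1 3 * A.val 3 4 + A.val 1 4) * (A.val 1 1)⁻¹;
           0, 0, (A.val 2 2)⁻¹,
           -(A.val 2 3) * (A.val 2 2)⁻¹,
           (A.val 2 3 * A.val 3 4 - A.val 2 4) * (A.val 2 2)⁻¹;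
           0, 0, 0, 1, -(A.val 3 4);
           0, 0, 0, 0, 1] := by
      apply Units.inv_eq_of_mul_eq_one_right
      ext i j
      rw [Matrix.mul_apply, Fin.sum_univ_five]
      fin_cases i <;> fin_cases j <;>
        simp [Matrix.one_apply, Matrix.vecHead, Matrix.vecTail,
          a00, a33, a44, a10, a20, a21, a30, a31, a32, a40, a41, a42, a43,
          -mul_eq_zero] <;>
        field_simp <;>
        ring
    refine ⟨⟨-na, ?_⟩, ⟨-ka, ?_⟩, ⟨-ma, ?_⟩, ?_, ?_, ?_, ?_, ?_, ?_, ?_, ?_, ?_, ?_, ?_,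
      ?_, ?_, ?_, ?_, ?_, ?_, ?_, ?_, ?_, ?_, ?_⟩ <;> rw [hinv]
    · show (A.val 1 1)⁻¹ = (p : ℚ) ^ (-na)
      rw [a11, ← zpow_neg]
    · show (A.val 2 2)⁻¹ = (p : ℚ) ^ (-ka)
      rw [a22, ← zpow_neg]
    · show -(A.val 3 4) = ((-ma : ℤ) : ℚ)
      rw [a34]; push_cast; ring
    · show (1 : ℚ) = 1; rfl
    · show (1 : ℚ) = 1; rfl
    · show (1 : ℚ) = 1; rfl
    · show -(A.val 0 1) * (A.val 1 1)⁻¹ ∈ Zp p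
      exact Zp.mul_mem ((Zp p).neg_mem a01) hiu
    · show A.val 0 1 * A.val 1 2 * (A.val 1 1)⁻¹ * (A.val 2 2)⁻¹ -
          A.val 0 2 * (A.val 2 2)⁻¹ ∈ Zp p
      exact (Zp p).sub_mem (Zp.mul_mem (Zp.mul_mem (Zp.mul_mem a01 a12) hiu) hiv)
        (Zp.mul_mem a02 hiv)
    · show -(A.val 0 1) * (A.val 1 2 * A.val 2 3 * (A.val 2 2)⁻¹ - A.val 1 3) *
          (A.val 1 1)⁻¹ + A.val 0 2 * A.val 2 3 * (A.val 2 2)⁻¹ - A.val 0 3 ∈ Zp p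
      exact (Zp p).sub_mem ((Zp p).add_mem
        (Zp.mul_mem (Zp.mul_mem ((Zp p).neg_mem a01)
          ((Zp p).sub_mem (Zp.mul_mem (Zp.mul_mem a12 a23) hiv) a13)) hiu)
        (Zp.mul_mem (Zp.mul_mem a02 a23) hiv)) a03
    · show A.val 0 1 * (A.val 1 2 * (A.val 2 3 * A.val 3 4 - A.val 2 4) * (A.val 2 2)⁻¹ -
            A.val 1 3 * A.val 3 4 + A.val 1 4) * (A.val 1 1)⁻¹ -
          A.val 0 2 * (A.val 2 3 * A.val 3 4 - A.val 2 4) * (A.val 2 2)⁻¹ +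
          A.val 0 3 * A.val 3 4 - A.val 0 4 ∈ Zp p
      refine (Zp p).sub_mem ((Zp p).add_mem ((Zp p).sub_mem ?_ ?_) ?_) a04
      · exact Zp.mul_mem (Zp.mul_mem a01 ((Zp p).add_mem ((Zp p).sub_mem
          (Zp.mul_mem (Zp.mul_mem a12 ((Zp p).sub_mem (Zp.mul_mem a23 hm) a24)) hiv)
          (Zp.mul_mem a13 hm)) a14)) hiu
      · exact Zp.mul_mem (Zp.mul_mem a02 ((Zp p).sub_mem (Zp.mul_mem a23 hm) a24)) hiv
      · exact Zp.mul_mem a03 hm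
    · show -(A.val 1 2) * (A.val 2 2)⁻¹ * (A.val 1 1)⁻¹ ∈ Zp p
      exact Zp.mul_mem (Zp.mul_mem ((Zp p).neg_mem a12) hiv) hiu
    · show (A.val 1 2 * A.val 2 3 * (A.val 2 2)⁻¹ - A.val 1 3) * (A.val 1 1)⁻¹ ∈ Zp p
      exact Zp.mul_mem ((Zp p).sub_mem (Zp.mul_mem (Zp.mul_mem a12 a23) hiv) a13) hiu
    · show -(A.val 1 2 * (A.val 2 3 * A.val 3 4 - A.val 2 4) * (A.val 2 2)⁻¹ -
            A.val 1 3 * A.val 3 4 + A.val 1 4) * (A.val 1 1)⁻¹ ∈ Zp p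
      exact Zp.mul_mem ((Zp p).neg_mem ((Zp p).add_mem ((Zp p).sub_mem
        (Zp.mul_mem (Zp.mul_mem a12 ((Zp p).sub_mem (Zp.mul_mem a23 hm) a24)) hiv)
        (Zp.mul_mem a13 hm)) a14)) hiu
    · show -(A.val 2 3) * (A.val 2 2)⁻¹ ∈ Zp p
      exact Zp.mul_mem ((Zp p).neg_mem a23) hiv
    · show (A.val 2 3 * A.val 3 4 - A.val 2 4) * (A.val 2 2)⁻¹ ∈ Zp p
      exact Zp.mul_mem ((Zp p).sub_mem (Zp.mul_mem a23 hm) a24) hiv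
    · show (0 : ℚ) = 0; rfl
    · show (0 : ℚ) = 0; rfl
    · show (0 : ℚ) = 0; rfl
    · show (0 : ℚ) = 0; rfl
    · show (0 : ℚ) = 0; rfl
    · show (0 : ℚ) = 0; rfl
    · show (0 : ℚ) = 0; rfl
    · show (0 : ℚ) = 0; rfl
    · show (0 : ℚ) = 0; rfl
    · show (0 : ℚ) = 0; rfl

/-! ### Exponential maps into a group -/

/-- A map turning addition into multiplication. -/
def IsExp {A Γ : Type*} [Add A] [Mul Γ] (e : A → Γ) : Prop := ∀ x y, e (x + y) = e x * e y

namespace IsExp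

variable {Γ : Type*} [Group Γ]

section AddGroup

variable {A : Type*} [AddCommGroup A] {e f : A → Γ}

lemma map_zero (he : IsExp e) : e 0 = 1 := by
  have h := he 0 0
  rw [add_zero] at h
  exact left_eq_mul.mp h

lemma map_neg (he : IsExp e) (x : A) : e (-x) = (e x)⁻¹ := by
  rw [eq_inv_iff_mul_eq_one, ← he, neg_add_cancel, he.map_zero]

lemma commute (he : IsExp e) (x y : A) : Commute (e x) (e y) := by
  rw [Commute, SemiconjBy, ← he, ← he, add_comm]

lemma map_zsmul (he : IsExp e) (k : ℤ) (x : A) : e (k • x) = e x ^ k := by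
  induction k using Int.induction_on with
  | zero => simp [he.map_zero]
  | succ k ih => rw [add_smul, one_smul, he, ih, zpow_add_one]
  | pred k ih => rw [sub_smul, one_smul, sub_eq_add_neg, he, ih, he.map_neg, zpow_sub_one]

lemma mul (he : IsExp e) (hf : IsExp f) (h : ∀ x y, Commute (e x) (f y)) :
    IsExp fun x => e x * f x := fun x y => by
  simp only [he x y, hf x y]
  exact (h y x).mul_mul_mul_comm (e x) (f y)

lemma comp {B : Type*} [AddCommGroup B] (he : IsExp e) (φ : B →+ A) :
    IsExp fun x => e (φ x) := fun x y => by
  simp only [map_add, he _ _]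

lemma conj (he : IsExp e) (σ : Γ) : IsExp fun x => σ * e x * σ⁻¹ := fun x y => by
  simp only [he _ _]; group

lemma map {Δ : Type*} [Group Δ] (he : IsExp e) (π : Γ →* Δ) : IsExp fun x => π (e x) :=
  fun x y => by simp only [he _ _, _root_.map_mul]

end AddGroup

section Ring

variable {R : Type*} [CommRing R] {p : ℕ} {e f h : R → Γ}

lemma map_intCast (he : IsExp e) (k : ℤ) : e k = e 1 ^ k := by
  rw [← he.map_zsmul, zsmul_one]

lemma map_natCast (he : IsExp e) (k : ℕ) : e k = e 1 ^ k := by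
  have := he.map_intCast k
  simpa using this

lemma mulLeft (he : IsExp e) (r : R) : IsExp fun x => e (r * x) :=
  he.comp (AddMonoidHom.mulLeft r)

lemma semiconjBy_pow {τ : Γ} (hτ : ∀ x, SemiconjBy τ (e x) (e (p * x))) (n : ℕ) (x : R) :
    SemiconjBy (τ ^ n) (e x) (e (p ^ n * x)) := by
  induction n with
  | zero => simp
  | succ n ih =>
    rw [pow_succ', pow_succ', mul_assoc]
    exact (hτ _).mul_left ih

/-- Two exponential maps on `ℤ[1/p]` that agree at `1` and are both rescaled by `τ` agree. -/
lemma eq_of_one (hR : ∀ x : R, ∃ (n : ℕ) (k : ℤ), (p : R) ^ n * x = k)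
    (he : IsExp e) (hf : IsExp f) {τ : Γ}
    (hτe : ∀ x, SemiconjBy τ (e x) (e (p * x))) (hτf : ∀ x, SemiconjBy τ (f x) (f (p * x)))
    (h1 : e 1 = f 1) (x : R) : e x = f x := by
  obtain ⟨n, k, hk⟩ := hR x
  have h2 := semiconjBy_pow hτe n x
  have h3 := semiconjBy_pow hτf n x
  rw [hk, he.map_intCast] at h2
  rw [hk, hf.map_intCast, ← h1] at h3
  exact mul_left_cancel (h2.eq.trans h3.eq.symm)

lemma semiconjBy_of_one (hR : ∀ x : R, ∃ (n : ℕ) (k : ℤ), (p : R) ^ n * x = k)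
    (he : IsExp e) (hf : IsExp f) {τ σ : Γ}
    (hτe : ∀ x, SemiconjBy τ (e x) (e (p * x))) (hτf : ∀ x, SemiconjBy τ (f x) (f (p * x)))
    (hτσ : Commute τ σ) (h1 : SemiconjBy σ (e 1) (f 1)) (x : R) :
    SemiconjBy σ (e x) (f x) := by
  have := eq_of_one hR (he.conj σ) hf (τ := τ)
    (fun x => (SemiconjBy.mul_right hτσ (hτe x)).mul_right hτσ.inv_right) hτf
    (mul_inv_eq_of_eq_mul h1.eq) x
  exact mul_inv_eq_iff_eq_mul.mp this

/-- The relation `e x * f y = h (x * y) * f y * e x` follows from the case `x = y = 1` when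
`e` and `f` can be rescaled independently. -/
lemma heisenberg (hR : ∀ x : R, ∃ (n : ℕ) (k : ℤ), (p : R) ^ n * x = k)
    (he : IsExp e) (hf : IsExp f) (hh : IsExp h)
    (hhe : ∀ x y, Commute (h x) (e y)) (hhf : ∀ x y, Commute (h x) (f y)) {τ σ : Γ}
    (hτe : ∀ x, SemiconjBy τ (e x) (e (p * x))) (hτf : ∀ x, Commute τ (f x))
    (hτh : ∀ x, SemiconjBy τ (h x) (h (p * x)))
    (hσe : ∀ x, Commute σ (e x)) (hσf : ∀ x, SemiconjBy σ (f x) (f (p * x)))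
    (hσh : ∀ x, SemiconjBy σ (h x) (h (p * x)))
    (h1 : e 1 * f 1 = h 1 * f 1 * e 1) (x y : R) :
    e x * f y = h (x * y) * f y * e x := by
  have A : ∀ x, SemiconjBy (f 1) (e x) (h (-x) * e x) := by
    refine semiconjBy_of_one hR he
      ((hh.comp (-AddMonoidHom.id R)).mul he fun x y => hhe _ _) hτe (fun x => ?_) (hτf 1) ?_
    · have := (hτh (-x)).mul_right (hτe x)
      simpa using this
    · simp only [AddMonoidHom.neg_apply, AddMonoidHom.id_apply, SemiconjBy]
      rw [hh.map_neg, mul_assoc, h1]; group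
  have B : ∀ y, SemiconjBy (e x) (f y) (h (x * y) * f y) := by
    refine semiconjBy_of_one hR hf ((hh.mulLeft x).mul hf fun x y => hhf _ _) hσf
      (fun y => ?_) (hσe x) ?_
    · have := (hσh (x * y)).mul_right (hσf y)
      simpa [mul_left_comm] using this
    · have := (A x).eq
      rw [SemiconjBy, mul_one, mul_assoc, this, hh.map_neg]; group
  exact (B y).eq

/-- `e` and `f` commute as soon as `e 1` and `f 1` do, when they can be rescaled independently. -/
lemma commute_of_one (hR : ∀ x : R, ∃ (n : ℕ) (k : ℤ), (p : R) ^ n * x = k)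
    (he : IsExp e) (hf : IsExp f) {τ σ : Γ}
    (hτe : ∀ x, SemiconjBy τ (e x) (e (p * x))) (hτf : ∀ x, Commute τ (f x))
    (hσe : ∀ x, Commute σ (e x)) (hσf : ∀ x, SemiconjBy σ (f x) (f (p * x)))
    (h1 : Commute (e 1) (f 1)) (x y : R) : Commute (e x) (f y) := by
  have A : ∀ x, SemiconjBy (f 1) (e x) (e x) :=
    semiconjBy_of_one hR he he hτe hτe (hτf 1) h1.symm
  exact semiconjBy_of_one hR hf hf hσf hσf (hσe x) (A x).symm y

/-- `e` and `f` commute as soon as `e 1` and `f 1` do, when they can be rescaled together. -/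
lemma commute_of_one' (hR : ∀ x : R, ∃ (n : ℕ) (k : ℤ), (p : R) ^ n * x = k)
    (he : IsExp e) (hf : IsExp f) {τ : Γ}
    (hτe : ∀ x, SemiconjBy τ (e x) (e (p * x))) (hτf : ∀ x, SemiconjBy τ (f x) (f (p * x)))
    (h1 : Commute (e 1) (f 1)) (x y : R) : Commute (e x) (f y) := by
  obtain ⟨n, k, hk⟩ := hR x
  obtain ⟨m, l, hl⟩ := hR y
  have h2 := semiconjBy_pow hτe (m + n) x
  have h3 := semiconjBy_pow hτf (m + n) y
  rw [pow_add (p : R), mul_assoc, hk, ← Nat.cast_pow, ← Int.cast_natCast (R := R),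
    ← Int.cast_mul, he.map_intCast] at h2
  rw [pow_add (p : R), mul_comm ((p : R) ^ m), mul_assoc, hl, ← Nat.cast_pow,
    ← Int.cast_natCast (R := R), ← Int.cast_mul, hf.map_intCast] at h3
  have h4 := (h2.mul_right h3).eq
  rw [(h1.zpow_zpow _ _).eq, ← (h3.mul_right h2).eq] at h4
  exact mul_left_cancel h4

/-- If `τ * g = g ^ p * τ` then `k ↦ g ^ k` extends to an exponential map on `ℤ[1/p]` that is
rescaled by `τ`. -/
lemma exists_of_semiconjBy [CharZero R]
    (hR : ∀ x : R, ∃ (n : ℕ) (k : ℤ), (p : R) ^ n * x = k) {τ g : Γ}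
    (hτ : SemiconjBy τ g (g ^ p)) :
    ∃ e : R → Γ, IsExp e ∧ e 1 = g ∧ ∀ x, SemiconjBy τ (e x) (e (p * x)) := by
  have hpow : ∀ (m : ℕ) (k : ℤ), SemiconjBy (τ ^ m) (g ^ k) (g ^ (k * (p : ℤ) ^ m)) := by
    intro m k
    induction m with
    | zero => simp
    | succ m ih =>
      rw [pow_succ' (p : ℤ)]
      have h := (hτ.zpow_right (k * (p : ℤ) ^ m)).mul_left ih
      rwa [← zpow_natCast g, ← zpow_mul, mul_left_comm, ← pow_succ'] at h
  choose N K hNK using hR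
  obtain ⟨e, key⟩ : ∃ e : R → Γ, ∀ (x : R) (n : ℕ) (k : ℤ), (p : R) ^ n * x = k →
      SemiconjBy (τ ^ n) (e x) (g ^ k) := by
    refine ⟨fun x => (τ ^ N x)⁻¹ * g ^ K x * τ ^ N x, fun x n k hk => ?_⟩
    have hkK : K x * (p : ℤ) ^ n = k * (p : ℤ) ^ N x := by
      have : ((K x * (p : ℤ) ^ n : ℤ) : R) = ((k * (p : ℤ) ^ N x : ℤ) : R) := by
        push_cast
        rw [← hk, ← hNK]; ring
      exact_mod_cast this
    have hτ' : τ ^ N x * τ ^ n = τ ^ n * τ ^ N x := ((Commute.refl τ).pow_pow _ _).eq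
    apply mul_left_cancel (a := τ ^ N x)
    calc τ ^ N x * (τ ^ n * ((τ ^ N x)⁻¹ * g ^ K x * τ ^ N x))
        = τ ^ n * g ^ K x * τ ^ N x := by rw [← mul_assoc, hτ']; group
      _ = g ^ (K x * (p : ℤ) ^ n) * (τ ^ n * τ ^ N x) := by rw [(hpow n _).eq, mul_assoc]
      _ = τ ^ N x * (g ^ k * τ ^ n) := by
        rw [hkK, ← hτ', ← mul_assoc, ← (hpow _ k).eq, mul_assoc]
  refine ⟨e, fun x y => ?_, ?_, fun x => ?_⟩
  · have hx := hNK x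
    have hy := hNK y
    have h1 := key x (N x + N y) (K x * (p : ℤ) ^ N y) (by push_cast; rw [← hx]; ring)
    have h2 := key y (N x + N y) (K y * (p : ℤ) ^ N x) (by push_cast; rw [← hy]; ring)
    have h3 := key (x + y) (N x + N y) (K x * (p : ℤ) ^ N y + K y * (p : ℤ) ^ N x)
      (by push_cast; rw [← hx, ← hy]; ring)
    have h4 := (h1.mul_right h2).eq
    rw [← zpow_add, ← h3.eq] at h4
    exact (mul_left_cancel h4).symm
  · have h := key 1 0 1 (by simp)
    simpa [SemiconjBy] using h
  · have h1 := (key x (N x + 1) (K x * p) (by push_cast; rw [← hNK x]; ring)).eq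
    have h2 := (key (p * x) (N x) (K x * p) (by push_cast; rw [← hNK x]; ring)).eq
    rw [pow_succ, ← mul_assoc, ← h2, mul_assoc, mul_assoc] at h1
    exact mul_left_cancel h1

end Ring

end IsExp

/-! ### A group with the elementary relations of `G̃_p` -/

/-- The elementary relations between exponential maps `e12`, `e23`, `e13` and `E3`, `E2` (the
latter taking values in the last two columns) and the elements `s`, `t`, `u`. -/
structure GtFrame {Γ R : Type*} [Group Γ] [CommRing R] (p : ℕ) (s t u : Γ) (e12 e23 e13 : R → Γ)
    (E3 E2 : R × R → Γ) : Prop where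
  exp12 : IsExp e12
  exp23 : IsExp e23
  exp13 : IsExp e13
  exp3 : IsExp E3
  exp2 : IsExp E2
  comm12_3 : ∀ x v, Commute (e12 x) (E3 v)
  comm13_12 : ∀ x y, Commute (e13 x) (e12 y)
  comm13_23 : ∀ x y, Commute (e13 x) (e23 y)
  comm13_2 : ∀ x v, Commute (e13 x) (E2 v)
  comm2_23 : ∀ v x, Commute (E2 v) (e23 x)
  comm2_3 : ∀ v w, Commute (E2 v) (E3 w)
  rel13 : ∀ x y, e12 x * e23 y = e13 (x * y) * e23 y * e12 x
  rel2 : ∀ x v, e23 x * E3 v = E2 (x • v) * E3 v * e23 x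
  comm_s_t : Commute s t
  comm_u_s : Commute u s
  comm_u_t : Commute u t
  s12 : ∀ x, SemiconjBy s (e12 (p * x)) (e12 x)
  s23 : ∀ x, SemiconjBy s (e23 x) (e23 (p * x))
  s13 : ∀ x, Commute s (e13 x)
  s3 : ∀ v, Commute s (E3 v)
  s2 : ∀ v, SemiconjBy s (E2 v) (E2 ((p : R) • v))
  t12 : ∀ x, Commute t (e12 x)
  t23 : ∀ x, SemiconjBy t (e23 (p * x)) (e23 x)
  t13 : ∀ x, SemiconjBy t (e13 (p * x)) (e13 x)
  t3 : ∀ v, SemiconjBy t (E3 v) (E3 ((p : R) • v))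
  t2 : ∀ v, Commute t (E2 v)
  u12 : ∀ x, Commute u (e12 x)
  u23 : ∀ x, Commute u (e23 x)
  u13 : ∀ x, Commute u (e13 x)
  u3 : ∀ v, SemiconjBy u (E3 v) (E3 (v.1, v.2 - v.1))
  u2 : ∀ v, SemiconjBy u (E2 v) (E2 (v.1, v.2 - v.1))

namespace GtFrame

variable {Γ R : Type*} [Group Γ] [CommRing R] {p : ℕ} {s t u : Γ} {e12 e23 e13 : R → Γ}
  {E3 E2 : R × R → Γ}

/-- The exponential map onto the last two entries of the first row. -/
def E1 (_ : GtFrame p s t u e12 e23 e13 E3 E2) (v : R × R) : Γ :=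
  e12 1 * E2 v * (e12 1)⁻¹ * (E2 v)⁻¹

variable (F : GtFrame p s t u e12 e23 e13 E3 E2)

include F in
lemma commutator_eq (x y : R) (v : R × R) :
    e12 x * E2 (-(y • v)) * (e12 x)⁻¹ * (E2 (-(y • v)))⁻¹ =
      E3 v * e13 (x * y) * (E3 v)⁻¹ * (e13 (x * y))⁻¹ := by
  have h1 : e12 x * e23 y * (e12 x)⁻¹ = e13 (x * y) * e23 y := by
    rw [F.rel13]; group
  have h2 : E3 v * e23 y * (E3 v)⁻¹ = (E2 (y • v))⁻¹ * e23 y := by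
    rw [mul_inv_eq_iff_eq_mul, mul_assoc, F.rel2]; group
  have h3 : e12 x * E3 v = E3 v * e12 x := F.comm12_3 x v
  have h4 : e12 x * (E3 v * e23 y * (E3 v)⁻¹) * (e12 x)⁻¹ =
      E3 v * (e12 x * e23 y * (e12 x)⁻¹) * (E3 v)⁻¹ := by
    calc _ = (e12 x * E3 v) * e23 y * (e12 x * E3 v)⁻¹ := by group
      _ = (E3 v * e12 x) * e23 y * (E3 v * e12 x)⁻¹ := by rw [h3]
      _ = _ := by group
  rw [h1, h2] at h4
  have h5 : e12 x * (E2 (y • v))⁻¹ * (e12 x)⁻¹ * e13 (x * y) =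
      E3 v * e13 (x * y) * (E3 v)⁻¹ * (E2 (y • v))⁻¹ := by
    apply mul_right_cancel (b := e23 y)
    calc _ = e12 x * (E2 (y • v))⁻¹ * (e12 x)⁻¹ * (e12 x * e23 y * (e12 x)⁻¹) := by
          rw [h1]; group
      _ = e12 x * ((E2 (y • v))⁻¹ * e23 y) * (e12 x)⁻¹ := by group
      _ = E3 v * e13 (x * y) * (E3 v)⁻¹ * (E3 v * e23 y * (E3 v)⁻¹) := by rw [h4]; group
      _ = _ := by rw [h2]; group
  have h6 : (E2 (y • v))⁻¹ * (e13 (x * y))⁻¹ = (e13 (x * y))⁻¹ * (E2 (y • v))⁻¹ :=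
    (F.comm13_2 (x * y) (y • v)).symm.inv_inv.eq
  rw [F.exp2.map_neg, inv_inv]
  rw [← eq_mul_inv_iff_mul_eq] at h5
  rw [h5, mul_assoc _ (E2 (y • v))⁻¹, h6]
  group

lemma commutator12_2 (x : R) (v : R × R) :
    e12 x * E2 v * (e12 x)⁻¹ * (E2 v)⁻¹ = F.E1 (x • v) := by
  have h1 := F.commutator_eq x 1 (-v)
  have h2 := F.commutator_eq 1 x (-v)
  simp only [one_smul, neg_neg, mul_one, one_mul, smul_neg] at h1 h2
  rw [h1, E1, h2]

lemma commutator3_13 (x : R) (v : R × R) :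
    E3 v * e13 x * (E3 v)⁻¹ * (e13 x)⁻¹ = F.E1 (-(x • v)) := by
  have h1 := F.commutator_eq 1 x v
  rw [one_mul] at h1
  rw [← h1, E1]

lemma rel1 (x : R) (v : R × R) : e12 x * E2 v = F.E1 (x • v) * E2 v * e12 x := by
  rw [← F.commutator12_2]; group

lemma rel1' (x : R) (v : R × R) : E3 v * e13 x = F.E1 (-(x • v)) * e13 x * E3 v := by
  rw [← F.commutator3_13]; group

lemma comm1_12 (v : R × R) (x : R) : Commute (F.E1 v) (e12 x) := by
  have h := F.commutator3_13 1 (-v)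
  rw [one_smul, neg_neg] at h
  rw [← h]
  have h3 := (F.comm12_3 x (-v)).symm
  have h13 := F.comm13_12 1 x
  exact ((h3.mul_left h13).mul_left h3.inv_left).mul_left h13.inv_left

lemma comm1_3 (v w : R × R) : Commute (F.E1 v) (E3 w) := by
  have h12 := F.comm12_3 1 w
  have h2 := F.comm2_3 v w
  exact ((h12.mul_left h2).mul_left h12.inv_left).mul_left h2.inv_left

lemma comm1_23 (v : R × R) (x : R) : Commute (F.E1 v) (e23 x) := by
  have h1 : e23 x * e12 1 * (e23 x)⁻¹ = (e13 x)⁻¹ * e12 1 := by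
    have := F.rel13 1 x
    rw [one_mul] at this
    rw [mul_inv_eq_iff_eq_mul, mul_assoc, this]; group
  have h2 : e23 x * E2 v * (e23 x)⁻¹ = E2 v := by
    rw [mul_inv_eq_iff_eq_mul, (F.comm2_23 v x).eq]
  have h3 : Commute (F.E1 v) (e13 x) := by
    have h12 := (F.comm13_12 x 1).symm
    have h2 := (F.comm13_2 x v).symm
    exact ((h12.mul_left h2).mul_left h12.inv_left).mul_left h2.inv_left
  have h4 : e23 x * F.E1 v * (e23 x)⁻¹ = F.E1 v := by
    calc e23 x * F.E1 v * (e23 x)⁻¹ = (e23 x * e12 1 * (e23 x)⁻¹) * (e23 x * E2 v * (e23 x)⁻¹) *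
          (e23 x * e12 1 * (e23 x)⁻¹)⁻¹ * (e23 x * E2 v * (e23 x)⁻¹)⁻¹ := by rw [E1]; group
      _ = (e13 x)⁻¹ * (e12 1 * E2 v * (e12 1)⁻¹ * (e13 x * (E2 v)⁻¹)) := by
        rw [h1, h2]; group
      _ = (e13 x)⁻¹ * (F.E1 v * e13 x) := by
        rw [(F.comm13_2 x v).inv_right.eq, E1]; group
      _ = F.E1 v := by rw [h3.eq]; group
  rw [mul_inv_eq_iff_eq_mul] at h4
  exact h4.symm

lemma comm1_13 (v : R × R) (x : R) : Commute (F.E1 v) (e13 x) := by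
  have h12 := (F.comm13_12 x 1).symm
  have h2 := (F.comm13_2 x v).symm
  exact ((h12.mul_left h2).mul_left h12.inv_left).mul_left h2.inv_left

lemma comm1_2 (v w : R × R) : Commute (F.E1 v) (E2 w) := by
  have h : E2 w = e23 1 * E3 w * (e23 1)⁻¹ * (E3 w)⁻¹ := by
    rw [F.rel2, one_smul]; group
  have h23 := F.comm1_23 v 1
  have h3 := F.comm1_3 v w
  rw [h]
  exact ((h23.mul_right h3).mul_right h23.inv_right).mul_right h3.inv_right

lemma exp1 : IsExp F.E1 := fun v w => by
  have h := (F.comm1_2 w v).eq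
  have h' := (F.comm1_12 w 1).inv_right.eq
  calc F.E1 (v + w)
      = e12 1 * E2 v * (e12 1)⁻¹ * (F.E1 w * (E2 v)⁻¹) := by
        simp only [E1, F.exp2 v w]; group
    _ = F.E1 v * F.E1 w := by
        rw [(F.comm1_2 w v).inv_right.eq]; simp only [E1]; group

lemma semiconj1 {σ : Γ} {r : R} {v v' : R × R} (h12 : SemiconjBy σ (e12 1) (e12 r))
    (h2 : SemiconjBy σ (E2 v) (E2 v')) : SemiconjBy σ (F.E1 v) (F.E1 (r • v')) := by
  rw [← F.commutator12_2]
  exact ((h12.mul_right h2).mul_right h12.inv_right).mul_right h2.inv_right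

/-- The normal form of an element of a group with a frame. -/
def nf (v₁ v₂ v₃ : R × R) (z x y : R) (n k m : ℤ) : Γ :=
  F.E1 v₁ * (E2 v₂ * (E3 v₃ * (e13 z * (e12 x * (e23 y * (s ^ n * (t ^ k * u ^ m)))))))

/-- The set of elements that have a normal form. -/
def nfSet : Set Γ := {γ | ∃ v₁ v₂ v₃ z x y n k m, γ = F.nf v₁ v₂ v₃ z x y n k m}

lemma one_mem_nfSet : 1 ∈ F.nfSet :=
  ⟨0, 0, 0, 0, 0, 0, 0, 0, 0, by
    simp [nf, F.exp1.map_zero, F.exp2.map_zero, F.exp3.map_zero, F.exp13.map_zero,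
      F.exp12.map_zero, F.exp23.map_zero]⟩

lemma E2_mul_mem {γ : Γ} (w : R × R) (hγ : γ ∈ F.nfSet) : E2 w * γ ∈ F.nfSet := by
  obtain ⟨v₁, v₂, v₃, z, x, y, n, k, m, rfl⟩ := hγ
  refine ⟨v₁, w + v₂, v₃, z, x, y, n, k, m, ?_⟩
  rw [nf, nf, (F.comm1_2 v₁ w).symm.left_comm, F.exp2, mul_assoc]

lemma E3_mul_mem {γ : Γ} (w : R × R) (hγ : γ ∈ F.nfSet) : E3 w * γ ∈ F.nfSet := by
  obtain ⟨v₁, v₂, v₃, z, x, y, n, k, m, rfl⟩ := hγ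
  refine ⟨v₁, v₂, w + v₃, z, x, y, n, k, m, ?_⟩
  rw [nf, nf, (F.comm1_3 v₁ w).symm.left_comm, (F.comm2_3 v₂ w).symm.left_comm, F.exp3, mul_assoc]

lemma e13_mul_mem {γ : Γ} (r : R) (hγ : γ ∈ F.nfSet) : e13 r * γ ∈ F.nfSet := by
  obtain ⟨v₁, v₂, v₃, z, x, y, n, k, m, rfl⟩ := hγ
  refine ⟨v₁ + r • v₃, v₂, v₃, r + z, x, y, n, k, m, ?_⟩
  have h : ∀ W, e13 r * (E3 v₃ * W) = F.E1 (r • v₃) * (E3 v₃ * (e13 r * W)) := by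
    intro W
    have h' := F.rel1' r v₃
    rw [F.exp1.map_neg, mul_assoc, eq_inv_mul_iff_mul_eq] at h'
    rw [← mul_assoc, ← h']; group
  rw [nf, nf, (F.comm1_13 v₁ r).symm.left_comm, (F.comm13_2 r v₂).left_comm, h,
    (F.comm1_2 _ v₂).symm.left_comm, F.exp1, F.exp13]
  simp only [mul_assoc]

lemma e12_mul_mem {γ : Γ} (r : R) (hγ : γ ∈ F.nfSet) : e12 r * γ ∈ F.nfSet := by
  obtain ⟨v₁, v₂, v₃, z, x, y, n, k, m, rfl⟩ := hγ
  refine ⟨v₁ + r • v₂, v₂, v₃, z, r + x, y, n, k, m, ?_⟩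
  have h : ∀ W, e12 r * (E2 v₂ * W) = F.E1 (r • v₂) * (E2 v₂ * (e12 r * W)) := by
    intro W
    rw [← mul_assoc, F.rel1]; group
  rw [nf, nf, (F.comm1_12 v₁ r).symm.left_comm, h, (F.comm12_3 r v₃).left_comm,
    (F.comm13_12 z r).symm.left_comm, F.exp1, F.exp12]
  simp only [mul_assoc]

lemma e23_mul_mem {γ : Γ} (r : R) (hγ : γ ∈ F.nfSet) : e23 r * γ ∈ F.nfSet := by
  obtain ⟨v₁, v₂, v₃, z, x, y, n, k, m, rfl⟩ := hγ
  refine ⟨v₁, v₂ + r • v₃, v₃, z + -(x * r), x, r + y, n, k, m, ?_⟩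
  have h : ∀ W, e23 r * (E3 v₃ * W) = E2 (r • v₃) * (E3 v₃ * (e23 r * W)) := by
    intro W
    rw [← mul_assoc, F.rel2]; group
  have h' : ∀ W, e23 r * (e12 x * W) = e13 (-(x * r)) * (e12 x * (e23 r * W)) := by
    intro W
    rw [← mul_assoc (e12 x), F.rel13, F.exp13.map_neg]; group
  rw [nf, nf, (F.comm1_23 v₁ r).symm.left_comm, (F.comm2_23 v₂ r).symm.left_comm, h,
    (F.comm13_23 z r).symm.left_comm, h', F.exp2, F.exp13, F.exp23]
  simp only [mul_assoc]

lemma mul_mem_of_semiconj {γ σ : Γ} (hγ : γ ∈ F.nfSet)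
    (h12 : ∀ x, ∃ x', SemiconjBy σ (e12 x) (e12 x'))
    (h23 : ∀ x, ∃ x', SemiconjBy σ (e23 x) (e23 x'))
    (h13 : ∀ x, ∃ x', SemiconjBy σ (e13 x) (e13 x'))
    (h3 : ∀ v, ∃ v', SemiconjBy σ (E3 v) (E3 v'))
    (h2 : ∀ v, ∃ v', SemiconjBy σ (E2 v) (E2 v'))
    (h0 : ∀ n k m : ℤ, ∃ n' k' m' : ℤ,
      σ * (s ^ n * (t ^ k * u ^ m)) = s ^ n' * (t ^ k' * u ^ m')) :
    σ * γ ∈ F.nfSet := by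
  obtain ⟨v₁, v₂, v₃, z, x, y, n, k, m, rfl⟩ := hγ
  obtain ⟨r, hr⟩ := h12 1
  obtain ⟨w, hw⟩ := h2 v₁
  obtain ⟨v₂', h2⟩ := h2 v₂
  obtain ⟨v₃', h3⟩ := h3 v₃
  obtain ⟨z', h13⟩ := h13 z
  obtain ⟨x', h12⟩ := h12 x
  obtain ⟨y', h23⟩ := h23 y
  obtain ⟨n', k', m', h0⟩ := h0 n k m
  have key : ∀ {a b : Γ}, SemiconjBy σ a b → ∀ W, σ * (a * W) = b * (σ * W) := fun h W => by
    rw [← mul_assoc, h.eq, mul_assoc]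
  refine ⟨r • w, v₂', v₃', z', x', y', n', k', m', ?_⟩
  rw [nf, nf, key (F.semiconj1 hr hw), key h2, key h3, key h13, key h12, key h23, h0]

/-- In a group generated by the values of a frame, every element has a normal form. -/
theorem mem_nfSet {q : R} (hq : p * q = 1) {S : Set Γ} (hS : Subgroup.closure S = ⊤)
    (hmem : ∀ γ ∈ S, γ = s ∨ γ = t ∨ γ = u ∨ (∃ x, γ = e12 x) ∨ (∃ x, γ = e23 x) ∨
      (∃ x, γ = e13 x) ∨ (∃ v, γ = E3 v) ∨ ∃ v, γ = E2 v) (γ : Γ) : γ ∈ F.nfSet := by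
  have hq' : ∀ x : R, p * (q * x) = x := fun x => by rw [← mul_assoc, hq, one_mul]
  have hq'' : ∀ v : R × R, (p : R) • q • v = v := fun v => by rw [smul_smul, hq, one_smul]
  have hts : ∀ k n : ℤ, Commute (t ^ k) (s ^ n) := fun k n => F.comm_s_t.symm.zpow_zpow k n
  have inv : ∀ {A : Type _} {σ : Γ} {e : A → Γ} (φ : A → A) (_ : ∀ x, SemiconjBy σ (e (φ x)) (e x))
      (x : A), ∃ x', SemiconjBy σ⁻¹ (e x) (e x') :=
    fun φ h x => ⟨φ x, (h x).inv_symm_left⟩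
  have hs12 : ∀ x, SemiconjBy s (e12 x) (e12 (q * x)) := fun x => by
    simpa [hq'] using F.s12 (q * x)
  have ht23 : ∀ x, SemiconjBy t (e23 x) (e23 (q * x)) := fun x => by
    simpa [hq'] using F.t23 (q * x)
  have ht13 : ∀ x, SemiconjBy t (e13 x) (e13 (q * x)) := fun x => by
    simpa [hq'] using F.t13 (q * x)
  have hs23 : ∀ x, SemiconjBy s (e23 (q * x)) (e23 x) := fun x => by
    simpa [hq'] using F.s23 (q * x)
  have hs2 : ∀ v, SemiconjBy s (E2 (q • v)) (E2 v) := fun x => by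
    simpa only [hq''] using F.s2 (q • x)
  have ht3 : ∀ v, SemiconjBy t (E3 (q • v)) (E3 v) := fun x => by
    simpa only [hq''] using F.t3 (q • x)
  have hu2 : ∀ v : R × R, SemiconjBy u (E2 (v.1, v.2 + v.1)) (E2 v) := fun v => by
    simpa using F.u2 (v.1, v.2 + v.1)
  have hu3 : ∀ v : R × R, SemiconjBy u (E3 (v.1, v.2 + v.1)) (E3 v) := fun v => by
    simpa using F.u3 (v.1, v.2 + v.1)
  have hu0 : ∀ i n k m : ℤ, u ^ i * (s ^ n * (t ^ k * u ^ m)) = s ^ n * (t ^ k * u ^ (i + m)) := by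
    intro i n k m
    rw [(F.comm_u_s.zpow_zpow i n).left_comm, (F.comm_u_t.zpow_zpow i k).left_comm, zpow_add]
  have ht0 : ∀ i n k m : ℤ, t ^ i * (s ^ n * (t ^ k * u ^ m)) = s ^ n * (t ^ (i + k) * u ^ m) := by
    intro i n k m
    rw [(hts i n).left_comm, zpow_add, mul_assoc]
  have hs0 : ∀ i n k m : ℤ, s ^ i * (s ^ n * (t ^ k * u ^ m)) = s ^ (i + n) * (t ^ k * u ^ m) := by
    intro i n k m
    rw [zpow_add, mul_assoc]
  have hγ : γ ∈ Subgroup.closure S := hS ▸ Subgroup.mem_top γ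
  induction hγ using Subgroup.closure_induction_left with
  | one => exact F.one_mem_nfSet
  | mul_left σ hσ γ _ ih =>
    rcases hmem σ hσ with rfl | rfl | rfl | ⟨x, rfl⟩ | ⟨x, rfl⟩ | ⟨x, rfl⟩ | ⟨v, rfl⟩ | ⟨v, rfl⟩
    · exact F.mul_mem_of_semiconj ih (fun x => ⟨_, hs12 x⟩) (fun x => ⟨_, F.s23 x⟩)
        (fun x => ⟨_, F.s13 x⟩) (fun x => ⟨_, F.s3 x⟩) (fun x => ⟨_, F.s2 x⟩)
        (fun n k m => ⟨_, _, _, by simpa using hs0 1 n k m⟩)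
    · exact F.mul_mem_of_semiconj ih (fun x => ⟨_, F.t12 x⟩) (fun x => ⟨_, ht23 x⟩)
        (fun x => ⟨_, ht13 x⟩) (fun x => ⟨_, F.t3 x⟩) (fun x => ⟨_, F.t2 x⟩)
        (fun n k m => ⟨_, _, _, by simpa using ht0 1 n k m⟩)
    · exact F.mul_mem_of_semiconj ih (fun x => ⟨_, F.u12 x⟩) (fun x => ⟨_, F.u23 x⟩)
        (fun x => ⟨_, F.u13 x⟩) (fun x => ⟨_, F.u3 x⟩) (fun x => ⟨_, F.u2 x⟩)
        (fun n k m => ⟨_, _, _, by simpa using hu0 1 n k m⟩)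
    · exact F.e12_mul_mem x ih
    · exact F.e23_mul_mem x ih
    · exact F.e13_mul_mem x ih
    · exact F.E3_mul_mem v ih
    · exact F.E2_mul_mem v ih
  | inv_mul_cancel σ hσ γ _ ih =>
    rcases hmem σ hσ with rfl | rfl | rfl | ⟨x, rfl⟩ | ⟨x, rfl⟩ | ⟨x, rfl⟩ | ⟨v, rfl⟩ | ⟨v, rfl⟩
    · exact F.mul_mem_of_semiconj ih (inv _ F.s12) (inv _ hs23)
        (fun x => ⟨_, (F.s13 x).inv_left⟩) (fun x => ⟨_, (F.s3 x).inv_left⟩) (inv _ hs2)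
        (fun n k m => ⟨_, _, _, by simpa using hs0 (-1) n k m⟩)
    · exact F.mul_mem_of_semiconj ih (fun x => ⟨_, (F.t12 x).inv_left⟩) (inv _ F.t23)
        (inv _ F.t13) (inv _ ht3) (fun x => ⟨_, (F.t2 x).inv_left⟩)
        (fun n k m => ⟨_, _, _, by simpa using ht0 (-1) n k m⟩)
    · exact F.mul_mem_of_semiconj ih (fun x => ⟨_, (F.u12 x).inv_left⟩)
        (fun x => ⟨_, (F.u23 x).inv_left⟩) (fun x => ⟨_, (F.u13 x).inv_left⟩)
        (inv _ hu3) (inv _ hu2)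
        (fun n k m => ⟨_, _, _, by simpa using hu0 (-1) n k m⟩)
    · exact F.exp12.map_neg x ▸ F.e12_mul_mem (-x) ih
    · exact F.exp23.map_neg x ▸ F.e23_mul_mem (-x) ih
    · exact F.exp13.map_neg x ▸ F.e13_mul_mem (-x) ih
    · exact F.exp3.map_neg v ▸ F.E3_mul_mem (-v) ih
    · exact F.exp2.map_neg v ▸ F.E2_mul_mem (-v) ih

end GtFrame

/-- The defining relations of `G̃_p`, on generators `s = diag(1,p,1,1,1)`, `t = diag(1,1,p,1,1)`
and the elementary matrices `u`, `a`, `b`, `c`, `d`, `z`, `f`, `g` at the positions `45`, `12`,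
`23`, `34`, `35`, `13`, `24`, `25`. -/
structure GtSystem {Γ : Type*} [Monoid Γ] (p : ℕ) (s t u a b c d z f g : Γ) : Prop where
  st : s * t = t * s
  sa : s * a ^ p = a * s
  ta : t * a = a * t
  sb : s * b = b ^ p * s
  tb : t * b ^ p = b * t
  sc : s * c = c * s
  tc : t * c = c ^ p * t
  sd : s * d = d * s
  td : t * d = d ^ p * t
  sz : s * z = z * s
  tz : t * z ^ p = z * t
  sf : s * f = f ^ p * s
  tf : t * f = f * t
  sg : s * g = g ^ p * s
  tg : t * g = g * t
  us : u * s = s * u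
  ut : u * t = t * u
  ua : u * a = a * u
  ub : u * b = b * u
  uz : u * z = z * u
  ud : u * d = d * u
  ug : u * g = g * u
  uc : u * (c * d) = c * u
  uf : u * (f * g) = f * u
  ac : a * c = c * a
  ad : a * d = d * a
  cd : c * d = d * c
  fg : f * g = g * f
  ab : a * b = z * b * a
  za : z * a = a * z
  zb : z * b = b * z
  bc : b * c = f * c * b
  fb : f * b = b * f
  fc : f * c = c * f
  fd : f * d = d * f
  bd : b * d = g * d * b
  gb : g * b = b * g
  gc : g * c = c * g
  gd : g * d = d * g
  zf : z * f = f * z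
  zg : z * g = g * z

/-- The defining relations produce a frame over `ℤ[1/p]`. -/
theorem GtSystem.exists_frame {Γ R : Type*} [Group Γ] [CommRing R] [CharZero R] {p : ℕ}
    (hR : ∀ x : R, ∃ (n : ℕ) (k : ℤ), (p : R) ^ n * x = k) {s t u a b c d z f g : Γ}
    (h : GtSystem p s t u a b c d z f g) :
    ∃ (e12 e23 e13 : R → Γ) (E3 E2 : R × R → Γ), GtFrame p s t u e12 e23 e13 E3 E2 ∧
      e12 1 = a ∧ e23 1 = b ∧ e13 1 = z ∧ E3 (1, 0) = c ∧ E3 (0, 1) = d ∧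
      E2 (1, 0) = f ∧ E2 (0, 1) = g := by
  obtain ⟨e12, exp12, rfl, s12⟩ :=
    IsExp.exists_of_semiconjBy hR (τ := s⁻¹) (g := a) (SemiconjBy.inv_symm_left h.sa)
  obtain ⟨e23, exp23, rfl, t23⟩ :=
    IsExp.exists_of_semiconjBy hR (τ := t⁻¹) (g := b) (SemiconjBy.inv_symm_left h.tb)
  obtain ⟨e13, exp13, rfl, t13⟩ :=
    IsExp.exists_of_semiconjBy hR (τ := t⁻¹) (g := z) (SemiconjBy.inv_symm_left h.tz)
  obtain ⟨e34, exp34, rfl, t34⟩ := IsExp.exists_of_semiconjBy hR (τ := t) (g := c) h.tc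
  obtain ⟨e35, exp35, rfl, t35⟩ := IsExp.exists_of_semiconjBy hR (τ := t) (g := d) h.td
  obtain ⟨e24, exp24, rfl, s24⟩ := IsExp.exists_of_semiconjBy hR (τ := s) (g := f) h.sf
  obtain ⟨e25, exp25, rfl, s25⟩ := IsExp.exists_of_semiconjBy hR (τ := s) (g := g) h.sg
  have hst : Commute s t := h.st
  have hus : Commute u s := h.us
  have hut : Commute u t := h.ut
  -- the action of `s`, `t` and `u`
  have t12 : ∀ x, Commute t (e12 x) :=
    IsExp.semiconjBy_of_one hR exp12 exp12 s12 s12 hst.inv_left h.ta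
  have s23 : ∀ x, SemiconjBy s (e23 x) (e23 (p * x)) :=
    IsExp.semiconjBy_of_one hR exp23 (exp23.mulLeft p) t23 (fun x => t23 _) hst.symm.inv_left
      (by rw [mul_one, exp23.map_natCast]; exact h.sb)
  have s13 : ∀ x, Commute s (e13 x) :=
    IsExp.semiconjBy_of_one hR exp13 exp13 t13 t13 hst.symm.inv_left h.sz
  have s34 : ∀ x, Commute s (e34 x) :=
    IsExp.semiconjBy_of_one hR exp34 exp34 t34 t34 hst.symm h.sc
  have s35 : ∀ x, Commute s (e35 x) :=
    IsExp.semiconjBy_of_one hR exp35 exp35 t35 t35 hst.symm h.sd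
  have t24 : ∀ x, Commute t (e24 x) :=
    IsExp.semiconjBy_of_one hR exp24 exp24 s24 s24 hst h.tf
  have t25 : ∀ x, Commute t (e25 x) :=
    IsExp.semiconjBy_of_one hR exp25 exp25 s25 s25 hst h.tg
  have u12 : ∀ x, Commute u (e12 x) :=
    IsExp.semiconjBy_of_one hR exp12 exp12 s12 s12 hus.symm.inv_left h.ua
  have u23 : ∀ x, Commute u (e23 x) :=
    IsExp.semiconjBy_of_one hR exp23 exp23 t23 t23 hut.symm.inv_left h.ub
  have u13 : ∀ x, Commute u (e13 x) :=
    IsExp.semiconjBy_of_one hR exp13 exp13 t13 t13 hut.symm.inv_left h.uz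
  have u35 : ∀ x, Commute u (e35 x) :=
    IsExp.semiconjBy_of_one hR exp35 exp35 t35 t35 hut.symm h.ud
  have u25 : ∀ x, Commute u (e25 x) :=
    IsExp.semiconjBy_of_one hR exp25 exp25 s25 s25 hus.symm h.ug
  have c34_35 : ∀ x y, Commute (e34 x) (e35 y) :=
    IsExp.commute_of_one' hR exp34 exp35 t34 t35 h.cd
  have c24_25 : ∀ x y, Commute (e24 x) (e25 y) :=
    IsExp.commute_of_one' hR exp24 exp25 s24 s25 h.fg
  have u34 : ∀ x, SemiconjBy u (e34 x * e35 x) (e34 x) :=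
    IsExp.semiconjBy_of_one hR (exp34.mul exp35 c34_35) exp34 (fun x => (t34 x).mul_right (t35 x))
      t34 hut.symm h.uc
  have u24 : ∀ x, SemiconjBy u (e24 x * e25 x) (e24 x) :=
    IsExp.semiconjBy_of_one hR (exp24.mul exp25 c24_25) exp24 (fun x => (s24 x).mul_right (s25 x))
      s24 hus.symm h.uf
  -- independent rescalings
  have s12' : ∀ x, SemiconjBy s (e12 (p * x)) (e12 x) := fun x => by
    simpa using (s12 x).inv_symm_left
  have t23' : ∀ x, SemiconjBy t (e23 (p * x)) (e23 x) := fun x => by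
    simpa using (t23 x).inv_symm_left
  have t13' : ∀ x, SemiconjBy t (e13 (p * x)) (e13 x) := fun x => by
    simpa using (t13 x).inv_symm_left
  have st23 : ∀ x, Commute (s * t) (e23 x) := fun x => by
    rw [Commute, hst.eq]
    exact (t23' x).mul_left (s23 x)
  have st12 : ∀ x, SemiconjBy (s * t)⁻¹ (e12 x) (e12 (p * x)) := fun x =>
    ((s12' x).mul_left (t12 _)).inv_symm_left
  have st13 : ∀ x, SemiconjBy (s * t)⁻¹ (e13 x) (e13 (p * x)) := fun x =>
    SemiconjBy.inv_symm_left (SemiconjBy.mul_left (s13 x) (t13' x))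
  have st24 : ∀ x, SemiconjBy (s * t) (e24 x) (e24 (p * x)) := fun x =>
    (s24 x).mul_left (t24 x)
  have st25 : ∀ x, SemiconjBy (s * t) (e25 x) (e25 (p * x)) := fun x =>
    (s25 x).mul_left (t25 x)
  have st34 : ∀ x, SemiconjBy (s * t) (e34 x) (e34 (p * x)) := fun x =>
    SemiconjBy.mul_left (s34 _) (t34 x)
  have st35 : ∀ x, SemiconjBy (s * t) (e35 x) (e35 (p * x)) := fun x =>
    SemiconjBy.mul_left (s35 _) (t35 x)
  -- the commutation relations
  have c12_34 : ∀ x y, Commute (e12 x) (e34 y) :=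
    IsExp.commute_of_one hR exp12 exp34 s12 (fun x => (s34 x).inv_left) t12 t34 h.ac
  have c12_35 : ∀ x y, Commute (e12 x) (e35 y) :=
    IsExp.commute_of_one hR exp12 exp35 s12 (fun x => (s35 x).inv_left) t12 t35 h.ad
  have c13_12 : ∀ x y, Commute (e13 x) (e12 y) :=
    IsExp.commute_of_one hR exp13 exp12 t13 (fun x => (t12 x).inv_left)
      (fun x => (s13 x).inv_left) s12 h.za
  have c13_23 : ∀ x y, Commute (e13 x) (e23 y) :=
    IsExp.commute_of_one hR exp13 exp23 st13 (fun x => (st23 x).inv_left) s13 s23 h.zb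
  have c13_24 : ∀ x y, Commute (e13 x) (e24 y) :=
    IsExp.commute_of_one hR exp13 exp24 t13 (fun x => (t24 x).inv_left) s13 s24 h.zf
  have c13_25 : ∀ x y, Commute (e13 x) (e25 y) :=
    IsExp.commute_of_one hR exp13 exp25 t13 (fun x => (t25 x).inv_left) s13 s25 h.zg
  have c24_23 : ∀ x y, Commute (e24 x) (e23 y) :=
    IsExp.commute_of_one hR exp24 exp23 st24 st23 (fun x => (t24 x).inv_left) t23 h.fb
  have c25_23 : ∀ x y, Commute (e25 x) (e23 y) :=
    IsExp.commute_of_one hR exp25 exp23 st25 st23 (fun x => (t25 x).inv_left) t23 h.gb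
  have c24_34 : ∀ x y, Commute (e24 x) (e34 y) :=
    IsExp.commute_of_one hR exp24 exp34 s24 s34 t24 t34 h.fc
  have c24_35 : ∀ x y, Commute (e24 x) (e35 y) :=
    IsExp.commute_of_one hR exp24 exp35 s24 s35 t24 t35 h.fd
  have c25_34 : ∀ x y, Commute (e25 x) (e34 y) :=
    IsExp.commute_of_one hR exp25 exp34 s25 s34 t25 t34 h.gc
  have c25_35 : ∀ x y, Commute (e25 x) (e35 y) :=
    IsExp.commute_of_one hR exp25 exp35 s25 s35 t25 t35 h.gd
  have r13 : ∀ x y, e12 x * e23 y = e13 (x * y) * e23 y * e12 x :=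
    IsExp.heisenberg hR exp12 exp23 exp13 c13_12 c13_23 st12 (fun x => (st23 x).inv_left) st13
      (fun x => (t12 x).inv_left) t23 t13 h.ab
  have r24 : ∀ x y, e23 x * e34 y = e24 (x * y) * e34 y * e23 x :=
    IsExp.heisenberg hR exp23 exp34 exp24 c24_23 c24_34 s23 s34 s24 st23 st34 st24 h.bc
  have r25 : ∀ x y, e23 x * e35 y = e25 (x * y) * e35 y * e23 x :=
    IsExp.heisenberg hR exp23 exp35 exp25 c25_23 c25_35 s23 s35 s25 st23 st35 st25 h.bd
  refine ⟨e12, e23, e13, fun v => e34 v.1 * e35 v.2, fun v => e24 v.1 * e25 v.2, ?_, rfl, rfl, rfl,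
    by simp [exp35.map_zero], by simp [exp34.map_zero], by simp [exp25.map_zero],
    by simp [exp24.map_zero]⟩
  exact
    { exp12 := exp12
      exp23 := exp23
      exp13 := exp13
      exp3 := (exp34.comp (AddMonoidHom.fst R R)).mul (exp35.comp (AddMonoidHom.snd R R))
        fun v w => c34_35 v.1 w.2
      exp2 := (exp24.comp (AddMonoidHom.fst R R)).mul (exp25.comp (AddMonoidHom.snd R R))
        fun v w => c24_25 v.1 w.2
      comm12_3 := fun x v => (c12_34 x v.1).mul_right (c12_35 x v.2)
      comm13_12 := c13_12
      comm13_23 := c13_23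
      comm13_2 := fun x v => (c13_24 x v.1).mul_right (c13_25 x v.2)
      comm2_23 := fun v x => (c24_23 v.1 x).mul_left (c25_23 v.2 x)
      comm2_3 := fun v w => ((c24_34 v.1 w.1).mul_right (c24_35 v.1 w.2)).mul_left
        ((c25_34 v.2 w.1).mul_right (c25_35 v.2 w.2))
      rel13 := r13
      rel2 := fun x v => by
        calc e23 x * (e34 v.1 * e35 v.2) = e24 (x * v.1) * e34 v.1 * (e23 x * e35 v.2) := by
              rw [← mul_assoc, r24]; group
          _ = e24 (x * v.1) * (e34 v.1 * e25 (x * v.2)) * e35 v.2 * e23 x := by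
              rw [r25]; group
          _ = e24 (x * v.1) * e25 (x * v.2) * (e34 v.1 * e35 v.2) * e23 x := by
              rw [(c25_34 (x * v.2) v.1).symm.eq]; group
      comm_s_t := hst
      comm_u_s := hus
      comm_u_t := hut
      s12 := s12'
      s23 := s23
      s13 := s13
      s3 := fun v => (s34 v.1).mul_right (s35 v.2)
      s2 := fun v => (s24 v.1).mul_right (s25 v.2)
      t12 := t12
      t23 := t23'
      t13 := t13'
      t3 := fun v => (t34 v.1).mul_right (t35 v.2)
      t2 := fun v => (t24 v.1).mul_right (t25 v.2)
      u12 := u12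
      u23 := u23
      u13 := u13
      u3 := fun v => by
        have := (u34 v.1).mul_right (u35 (v.2 - v.1))
        rwa [mul_assoc, ← exp35, add_sub_cancel] at this
      u2 := fun v => by
        have := (u24 v.1).mul_right (u25 (v.2 - v.1))
        rwa [mul_assoc, ← exp25, add_sub_cancel] at this }

/-! ### The ring `ℤ[1/p]` -/

/-- `ℤ[1/p]` as a subring of `ℚ`. -/
def ZpRing (p : ℕ) : Subring ℚ where
  carrier := Zp p
  mul_mem' := Zp.mul_mem
  one_mem' := by simpa using Zp.intCast_mem p 1
  add_mem' := (Zp p).add_mem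
  zero_mem' := (Zp p).zero_mem
  neg_mem' := (Zp p).neg_mem

namespace ZpRing

variable {p : ℕ}

lemma exists_pow_mul_eq (x : ZpRing p) : ∃ (n : ℕ) (k : ℤ), (p : ZpRing p) ^ n * x = k := by
  obtain ⟨x, k, n, h⟩ := x
  exact ⟨n, k, Subtype.ext (by push_cast; rw [← h, mul_comm])⟩

/-- `p` as a unit of `ℤ[1/p]`. -/
def unit (hp : p.Prime) : (ZpRing p)ˣ where
  val := p
  inv := ⟨(p : ℚ)⁻¹, by
    have := Zp.zpow_mem (p := p) (Nat.cast_ne_zero.mpr hp.ne_zero) (-1)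
    rwa [zpow_neg_one] at this⟩
  val_inv := Subtype.ext (by
    push_cast; exact mul_inv_cancel₀ (Nat.cast_ne_zero.mpr hp.ne_zero))
  inv_val := Subtype.ext (by
    push_cast; exact inv_mul_cancel₀ (Nat.cast_ne_zero.mpr hp.ne_zero))

@[simp]
lemma val_unit (hp : p.Prime) : (unit hp : ZpRing p) = p := rfl

lemma coe_unit_zpow (hp : p.Prime) (n : ℤ) :
    (((unit hp ^ n : (ZpRing p)ˣ) : ZpRing p) : ℚ) = (p : ℚ) ^ n := by
  have h := congrArg Units.val (map_zpow (Units.map (ZpRing p).subtype.toMonoidHom) (unit hp) n)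
  rw [Units.val_zpow_eq_zpow_val] at h
  exact h

end ZpRing

/-! ### Coordinates on `G̃_p` -/

section Coordinates

variable {p : ℕ} {hp : p.Prime}

/-- The matrix with the given entries. -/
def gtMatrix (hp : p.Prime) (n k m : ℤ) (x01 x02 x03 x04 x12 x13 x14 x23 x24 : ZpRing p) :
    Matrix (Fin 5) (Fin 5) ℚ :=
  !![1, x01, x02, x03, x04;
     0, ((ZpRing.unit hp ^ n : (ZpRing p)ˣ) : ZpRing p), x12, x13, x14;
     0, 0, ((ZpRing.unit hp ^ k : (ZpRing p)ˣ) : ZpRing p), x23, x24;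
     0, 0, 0, 1, m;
     0, 0, 0, 0, 1]

lemma isUnit_det_gtMatrix (n k m : ℤ) (x01 x02 x03 x04 x12 x13 x14 x23 x24 : ZpRing p) :
    IsUnit (gtMatrix hp n k m x01 x02 x03 x04 x12 x13 x14 x23 x24).det := by
  have hp0 : (p : ℚ) ≠ 0 := Nat.cast_ne_zero.mpr hp.ne_zero
  rw [Matrix.det_of_isUpperTriangular, Fin.prod_univ_five, isUnit_iff_ne_zero]
  · simp [gtMatrix, ZpRing.coe_unit_zpow, zpow_ne_zero _ hp0]
  · intro i j hij
    fin_cases i <;> fin_cases j <;> first | rfl | (exact absurd hij (by decide))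

/-- The element of `G̃_p` with the given entries. -/
noncomputable def gtMk (hp : p.Prime) (n k m : ℤ)
    (x01 x02 x03 x04 x12 x13 x14 x23 x24 : ZpRing p) : Gt p hp :=
  ⟨Matrix.nonsingInvUnit (gtMatrix hp n k m x01 x02 x03 x04 x12 x13 x14 x23 x24)
      (isUnit_det_gtMatrix ..),
    ⟨n, ZpRing.coe_unit_zpow hp n⟩, ⟨k, ZpRing.coe_unit_zpow hp k⟩, ⟨m, rfl⟩, rfl, rfl, rfl,
    x01.2, x02.2, x03.2, x04.2, x12.2, x13.2, x14.2, x23.2, x24.2,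
    rfl, rfl, rfl, rfl, rfl, rfl, rfl, rfl, rfl, rfl⟩

lemma coe_gtMk (n k m : ℤ) (x01 x02 x03 x04 x12 x13 x14 x23 x24 : ZpRing p) :
    ((gtMk hp n k m x01 x02 x03 x04 x12 x13 x14 x23 x24 : Gt p hp).1 : Matrix _ _ ℚ) =
      gtMatrix hp n k m x01 x02 x03 x04 x12 x13 x14 x23 x24 := rfl

lemma upperTriangular_mul {R : Type*} [CommRing R]
    (n k m x01 x02 x03 x04 x12 x13 x14 x23 x24 n' k' m' y01 y02 y03 y04 y12 y13 y14 y23 y24 : R) :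
    !![1, x01, x02, x03, x04; 0, n, x12, x13, x14; 0, 0, k, x23, x24; 0, 0, 0, 1, m;
        0, 0, 0, 0, 1] *
      !![1, y01, y02, y03, y04; 0, n', y12, y13, y14; 0, 0, k', y23, y24; 0, 0, 0, 1, m';
        0, 0, 0, 0, 1] =
    !![1, y01 + x01 * n', y02 + x01 * y12 + x02 * k', y03 + x01 * y13 + x02 * y23 + x03,
        y04 + x01 * y14 + x02 * y24 + x03 * m' + x04;
      0, n * n', n * y12 + x12 * k', n * y13 + x12 * y23 + x13,
        n * y14 + x12 * y24 + x13 * m' + x14;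
      0, 0, k * k', k * y23 + x23, k * y24 + x23 * m' + x24;
      0, 0, 0, 1, m + m'; 0, 0, 0, 0, 1] := by
  ext i j
  rw [Matrix.mul_apply, Fin.sum_univ_five]
  fin_cases i <;> fin_cases j <;> simp [add_comm]

lemma gtMk_mul (n k m : ℤ) (x01 x02 x03 x04 x12 x13 x14 x23 x24 : ZpRing p)
    (n' k' m' : ℤ) (y01 y02 y03 y04 y12 y13 y14 y23 y24 : ZpRing p) :
    gtMk hp n k m x01 x02 x03 x04 x12 x13 x14 x23 x24 *
      gtMk hp n' k' m' y01 y02 y03 y04 y12 y13 y14 y23 y24 =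
    gtMk hp (n + n') (k + k') (m + m')
      (y01 + x01 * ((ZpRing.unit hp ^ n' : (ZpRing p)ˣ) : ZpRing p))
      (y02 + x01 * y12 + x02 * ((ZpRing.unit hp ^ k' : (ZpRing p)ˣ) : ZpRing p))
      (y03 + x01 * y13 + x02 * y23 + x03)
      (y04 + x01 * y14 + x02 * y24 + x03 * m' + x04)
      (((ZpRing.unit hp ^ n : (ZpRing p)ˣ) : ZpRing p) * y12 +
        x12 * ((ZpRing.unit hp ^ k' : (ZpRing p)ˣ) : ZpRing p))
      (((ZpRing.unit hp ^ n : (ZpRing p)ˣ) : ZpRing p) * y13 + x12 * y23 + x13)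
      (((ZpRing.unit hp ^ n : (ZpRing p)ˣ) : ZpRing p) * y14 + x12 * y24 + x13 * m' + x14)
      (((ZpRing.unit hp ^ k : (ZpRing p)ˣ) : ZpRing p) * y23 + x23)
      (((ZpRing.unit hp ^ k : (ZpRing p)ˣ) : ZpRing p) * y24 + x23 * m' + x24) := by
  apply Subtype.ext
  apply Units.ext
  rw [Subgroup.coe_mul, Units.val_mul, coe_gtMk, coe_gtMk, coe_gtMk, gtMatrix, gtMatrix,
    upperTriangular_mul, gtMatrix, zpow_add, zpow_add]
  push_cast
  rfl

lemma exists_gtMk_eq (M : Gt p hp) : ∃ n k m x01 x02 x03 x04 x12 x13 x14 x23 x24,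
    gtMk hp n k m x01 x02 x03 x04 x12 x13 x14 x23 x24 = M := by
  obtain ⟨M, ⟨n, a11⟩, ⟨k, a22⟩, ⟨m, a34⟩, a00, a33, a44,
      a01, a02, a03, a04, a12, a13, a14, a23, a24,
      a10, a20, a21, a30, a31, a32, a40, a41, a42, a43⟩ := M
  refine ⟨n, k, m, ⟨_, a01⟩, ⟨_, a02⟩, ⟨_, a03⟩, ⟨_, a04⟩, ⟨_, a12⟩, ⟨_, a13⟩, ⟨_, a14⟩, ⟨_, a23⟩,
    ⟨_, a24⟩, ?_⟩
  apply Subtype.ext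
  apply Units.ext
  rw [coe_gtMk]
  ext i j
  fin_cases i <;> fin_cases j <;> simp [gtMatrix, ZpRing.coe_unit_zpow, *]

lemma gtMk_eq_one {n k m : ℤ} {x01 x02 x03 x04 x12 x13 x14 x23 x24 : ZpRing p}
    (h : gtMk hp n k m x01 x02 x03 x04 x12 x13 x14 x23 x24 = 1) :
    n = 0 ∧ k = 0 ∧ m = 0 ∧ x01 = 0 ∧ x02 = 0 ∧ x03 = 0 ∧ x04 = 0 ∧ x12 = 0 ∧ x13 = 0 ∧
      x14 = 0 ∧ x23 = 0 ∧ x24 = 0 := by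
  have hM : ∀ i j, gtMatrix hp n k m x01 x02 x03 x04 x12 x13 x14 x23 x24 i j =
      (1 : Matrix (Fin 5) (Fin 5) ℚ) i j := fun i j => by
    rw [← coe_gtMk, h]; rfl
  have hz : ∀ i : ℤ, (p : ℚ) ^ i = 1 → i = 0 := fun i hi =>
    (zpow_eq_one_iff_right₀ (by positivity) (by exact_mod_cast hp.one_lt.ne')).mp hi
  refine ⟨hz _ ?_, hz _ ?_, ?_, Subtype.ext (hM 0 1), Subtype.ext (hM 0 2), Subtype.ext (hM 0 3),
    Subtype.ext (hM 0 4), Subtype.ext (hM 1 2), Subtype.ext (hM 1 3), Subtype.ext (hM 1 4),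
    Subtype.ext (hM 2 3), Subtype.ext (hM 2 4)⟩
  · rw [← ZpRing.coe_unit_zpow hp]; exact hM 1 1
  · rw [← ZpRing.coe_unit_zpow hp]; exact hM 2 2
  · have := hM 3 4
    simpa [gtMatrix] using this

lemma gtMk_n_zpow (n : ℤ) :
    gtMk hp 1 0 0 0 0 0 0 0 0 0 0 0 ^ n = gtMk hp n 0 0 0 0 0 0 0 0 0 0 0 := by
  have h : IsExp fun n => gtMk hp n 0 0 0 0 0 0 0 0 0 0 0 := fun n n' => by simp [gtMk_mul]
  simpa using (h.map_intCast n).symm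

lemma gtMk_k_zpow (k : ℤ) :
    gtMk hp 0 1 0 0 0 0 0 0 0 0 0 0 ^ k = gtMk hp 0 k 0 0 0 0 0 0 0 0 0 0 := by
  have h : IsExp fun k => gtMk hp 0 k 0 0 0 0 0 0 0 0 0 0 := fun n n' => by simp [gtMk_mul]
  simpa using (h.map_intCast k).symm

lemma gtMk_m_zpow (m : ℤ) :
    gtMk hp 0 0 1 0 0 0 0 0 0 0 0 0 ^ m = gtMk hp 0 0 m 0 0 0 0 0 0 0 0 0 := by
  have h : IsExp fun m => gtMk hp 0 0 m 0 0 0 0 0 0 0 0 0 := fun n n' => by simp [gtMk_mul]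
  simpa using (h.map_intCast m).symm

end Coordinates

lemma isExp_gtMk12 {p : ℕ} {hp : p.Prime} :
    IsExp fun x => gtMk hp 0 0 0 x 0 0 0 0 0 0 0 0 := fun x y => by simp [gtMk_mul, add_comm]
lemma isExp_gtMk13 {p : ℕ} {hp : p.Prime} :
    IsExp fun x => gtMk hp 0 0 0 0 x 0 0 0 0 0 0 0 := fun x y => by simp [gtMk_mul, add_comm]
lemma isExp_gtMk23 {p : ℕ} {hp : p.Prime} :
    IsExp fun x => gtMk hp 0 0 0 0 0 0 0 x 0 0 0 0 := fun x y => by simp [gtMk_mul, add_comm]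
lemma isExp_gtMk24 {p : ℕ} {hp : p.Prime} :
    IsExp fun x => gtMk hp 0 0 0 0 0 0 0 0 x 0 0 0 := fun x y => by simp [gtMk_mul, add_comm]
lemma isExp_gtMk25 {p : ℕ} {hp : p.Prime} :
    IsExp fun x => gtMk hp 0 0 0 0 0 0 0 0 0 x 0 0 := fun x y => by simp [gtMk_mul, add_comm]
lemma isExp_gtMk34 {p : ℕ} {hp : p.Prime} :
    IsExp fun x => gtMk hp 0 0 0 0 0 0 0 0 0 0 x 0 := fun x y => by simp [gtMk_mul, add_comm]
lemma isExp_gtMk35 {p : ℕ} {hp : p.Prime} :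
    IsExp fun x => gtMk hp 0 0 0 0 0 0 0 0 0 0 0 x := fun x y => by simp [gtMk_mul, add_comm]

lemma gtSystem_gt {p : ℕ} (hp : p.Prime) : GtSystem p
    (gtMk hp 1 0 0 0 0 0 0 0 0 0 0 0) (gtMk hp 0 1 0 0 0 0 0 0 0 0 0 0)
    (gtMk hp 0 0 1 0 0 0 0 0 0 0 0 0) (gtMk hp 0 0 0 1 0 0 0 0 0 0 0 0)
    (gtMk hp 0 0 0 0 0 0 0 1 0 0 0 0) (gtMk hp 0 0 0 0 0 0 0 0 0 0 1 0)
    (gtMk hp 0 0 0 0 0 0 0 0 0 0 0 1) (gtMk hp 0 0 0 0 1 0 0 0 0 0 0 0)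
    (gtMk hp 0 0 0 0 0 0 0 0 1 0 0 0) (gtMk hp 0 0 0 0 0 0 0 0 0 1 0 0) := by
  constructor <;>
    simp [gtMk_mul, ← isExp_gtMk12.map_natCast, ← isExp_gtMk13.map_natCast,
      ← isExp_gtMk23.map_natCast, ← isExp_gtMk24.map_natCast, ← isExp_gtMk25.map_natCast,
      ← isExp_gtMk34.map_natCast, ← isExp_gtMk35.map_natCast]

/-! ### The presentation -/

section Presentation

/-- The two sides of the equations in `GtSystem`. -/
def gtRelations {Γ : Type*} [Monoid Γ] (p : ℕ) (s t u a b c d z f g : Γ) : List (Γ × Γ) :=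
  [(s * t, t * s), (s * a ^ p, a * s), (t * a, a * t), (s * b, b ^ p * s), (t * b ^ p, b * t),
   (s * c, c * s), (t * c, c ^ p * t), (s * d, d * s), (t * d, d ^ p * t), (s * z, z * s),
   (t * z ^ p, z * t), (s * f, f ^ p * s), (t * f, f * t), (s * g, g ^ p * s), (t * g, g * t),
   (u * s, s * u), (u * t, t * u), (u * a, a * u), (u * b, b * u), (u * z, z * u), (u * d, d * u),
   (u * g, g * u), (u * (c * d), c * u), (u * (f * g), f * u), (a * c, c * a), (a * d, d * a),
   (c * d, d * c), (f * g, g * f), (a * b, z * b * a), (z * a, a * z), (z * b, b * z),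
   (b * c, f * c * b), (f * b, b * f), (f * c, c * f), (f * d, d * f), (b * d, g * d * b),
   (g * b, b * g), (g * c, c * g), (g * d, d * g), (z * f, f * z), (z * g, g * z)]

lemma gtSystem_iff {Γ : Type*} [Monoid Γ] {p : ℕ} {s t u a b c d z f g : Γ} :
    GtSystem p s t u a b c d z f g ↔ ∀ r ∈ gtRelations p s t u a b c d z f g, r.1 = r.2 := by
  simp only [gtRelations, List.forall_mem_cons, List.not_mem_nil, false_imp_iff, implies_true,
    and_true]
  constructor
  · rintro ⟨⟩
    and_intros <;> assumption
  · rintro ⟨_, _, _, _, _, _, _, _, _, _, _, _, _, _, _, _, _, _, _, _, _, _, _, _, _, _, _, _,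
      _, _, _, _, _, _, _, _, _, _, _, _, _⟩
    constructor <;> assumption

lemma map_gtRelations {Γ Δ : Type*} [Monoid Γ] [Monoid Δ] (π : Γ →* Δ) (p : ℕ)
    (s t u a b c d z f g : Γ) :
    (gtRelations p s t u a b c d z f g).map (Prod.map π π) =
      gtRelations p (π s) (π t) (π u) (π a) (π b) (π c) (π d) (π z) (π f) (π g) := by
  simp [gtRelations]

/-- The relators of `G̃_p`. -/
def gtRelators (p : ℕ) : Set (FreeGroup (Fin 10)) :=
  {w | ∃ r ∈ gtRelations p (.of 0) (.of 1) (.of 2) (.of 3) (.of 4) (.of 5) (.of 6) (.of 7)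
    (.of 8) (.of 9), r.1 * r.2⁻¹ = w}

lemma finite_gtRelators (p : ℕ) : (gtRelators p).Finite :=
  (List.finite_toSet _).image
    fun r : FreeGroup (Fin 10) × FreeGroup (Fin 10) => r.1 * r.2⁻¹

/-- A homomorphism from the free group kills the relators exactly when the images of the
generators satisfy the system. -/
lemma gtSystem_iff_relators {Γ : Type*} [Group Γ] {p : ℕ} (π : FreeGroup (Fin 10) →* Γ) :
    GtSystem p (π (.of 0)) (π (.of 1)) (π (.of 2)) (π (.of 3)) (π (.of 4)) (π (.of 5))
      (π (.of 6)) (π (.of 7)) (π (.of 8)) (π (.of 9)) ↔ ∀ w ∈ gtRelators p, π w = 1 := by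
  rw [gtSystem_iff, ← map_gtRelations]
  simp only [gtRelators, List.forall_mem_map, Prod.map_fst, Prod.map_snd, Set.mem_ofPred_eq,
    forall_exists_index, and_imp, forall_apply_eq_imp_iff₂, map_mul, map_inv, mul_inv_eq_one]

lemma gtSystem_of (p : ℕ) : GtSystem p (PresentedGroup.of (rels := gtRelators p) 0) (.of 1)
    (.of 2) (.of 3) (.of 4) (.of 5) (.of 6) (.of 7) (.of 8) (.of 9) :=
  (gtSystem_iff_relators (PresentedGroup.mk (gtRelators p))).mpr fun _ hw =>
    PresentedGroup.one_of_mem hw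

end Presentation

/-! ### Mapping a frame to `G̃_p` -/

section MapFrame

variable {Γ : Type*} [Group Γ] {p : ℕ} {hp : p.Prime} {s t u : Γ} {e12 e23 e13 : ZpRing p → Γ}
  {E3 E2 : ZpRing p × ZpRing p → Γ} (F : GtFrame p s t u e12 e23 e13 E3 E2)
  (π : Γ →* Gt p hp) (hs : π s = gtMk hp 1 0 0 0 0 0 0 0 0 0 0 0)
  (ht : π t = gtMk hp 0 1 0 0 0 0 0 0 0 0 0 0)

include F

include hs in
lemma map_e12 (h1 : π (e12 1) = gtMk hp 0 0 0 1 0 0 0 0 0 0 0 0) (x : ZpRing p) :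
    π (e12 x) = gtMk hp 0 0 0 x 0 0 0 0 0 0 0 0 := by
  refine (F.exp12.map π).eq_of_one ZpRing.exists_pow_mul_eq isExp_gtMk12 (τ := (π s)⁻¹)
    (fun x => ((F.s12 x).map π).inv_symm_left) (fun x => SemiconjBy.inv_symm_left ?_) h1 x
  rw [hs, SemiconjBy]
  simp [gtMk_mul, mul_comm]

include ht in
lemma map_e23 (h1 : π (e23 1) = gtMk hp 0 0 0 0 0 0 0 1 0 0 0 0) (x : ZpRing p) :
    π (e23 x) = gtMk hp 0 0 0 0 0 0 0 x 0 0 0 0 := by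
  refine (F.exp23.map π).eq_of_one ZpRing.exists_pow_mul_eq isExp_gtMk23 (τ := (π t)⁻¹)
    (fun x => ((F.t23 x).map π).inv_symm_left) (fun x => SemiconjBy.inv_symm_left ?_) h1 x
  rw [ht, SemiconjBy]
  simp [gtMk_mul, mul_comm]

include ht in
lemma map_e13 (h1 : π (e13 1) = gtMk hp 0 0 0 0 1 0 0 0 0 0 0 0) (x : ZpRing p) :
    π (e13 x) = gtMk hp 0 0 0 0 x 0 0 0 0 0 0 0 := by
  refine (F.exp13.map π).eq_of_one ZpRing.exists_pow_mul_eq isExp_gtMk13 (τ := (π t)⁻¹)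
    (fun x => ((F.t13 x).map π).inv_symm_left) (fun x => SemiconjBy.inv_symm_left ?_) h1 x
  rw [ht, SemiconjBy]
  simp [gtMk_mul, mul_comm]

include ht in
lemma map_E3 (h1 : π (E3 (1, 0)) = gtMk hp 0 0 0 0 0 0 0 0 0 0 1 0)
    (h2 : π (E3 (0, 1)) = gtMk hp 0 0 0 0 0 0 0 0 0 0 0 1) (v : ZpRing p × ZpRing p) :
    π (E3 v) = gtMk hp 0 0 0 0 0 0 0 0 0 0 v.1 v.2 := by
  have hl (x : ZpRing p) : π (E3 (x, 0)) = gtMk hp 0 0 0 0 0 0 0 0 0 0 x 0 := by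
    refine ((F.exp3.comp (AddMonoidHom.inl _ _)).map π).eq_of_one ZpRing.exists_pow_mul_eq
      isExp_gtMk34 (τ := π t) (fun x => ?_) (fun x => ?_) h1 x
    · simpa using (F.t3 (x, 0)).map π
    · rw [ht, SemiconjBy]
      simp [gtMk_mul]
  have hr (x : ZpRing p) : π (E3 (0, x)) = gtMk hp 0 0 0 0 0 0 0 0 0 0 0 x := by
    refine ((F.exp3.comp (AddMonoidHom.inr _ _)).map π).eq_of_one ZpRing.exists_pow_mul_eq
      isExp_gtMk35 (τ := π t) (fun x => ?_) (fun x => ?_) h2 x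
    · simpa using (F.t3 (0, x)).map π
    · rw [ht, SemiconjBy]
      simp [gtMk_mul]
  rw [← Prod.fst_add_snd v, F.exp3, map_mul, hl, hr]
  simp [gtMk_mul]

include hs in
lemma map_E2 (h1 : π (E2 (1, 0)) = gtMk hp 0 0 0 0 0 0 0 0 1 0 0 0)
    (h2 : π (E2 (0, 1)) = gtMk hp 0 0 0 0 0 0 0 0 0 1 0 0) (v : ZpRing p × ZpRing p) :
    π (E2 v) = gtMk hp 0 0 0 0 0 0 0 0 v.1 v.2 0 0 := by
  have hl (x : ZpRing p) : π (E2 (x, 0)) = gtMk hp 0 0 0 0 0 0 0 0 x 0 0 0 := by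
    refine ((F.exp2.comp (AddMonoidHom.inl _ _)).map π).eq_of_one ZpRing.exists_pow_mul_eq
      isExp_gtMk24 (τ := π s) (fun x => ?_) (fun x => ?_) h1 x
    · simpa using (F.s2 (x, 0)).map π
    · rw [hs, SemiconjBy]
      simp [gtMk_mul]
  have hr (x : ZpRing p) : π (E2 (0, x)) = gtMk hp 0 0 0 0 0 0 0 0 0 x 0 0 := by
    refine ((F.exp2.comp (AddMonoidHom.inr _ _)).map π).eq_of_one ZpRing.exists_pow_mul_eq
      isExp_gtMk25 (τ := π s) (fun x => ?_) (fun x => ?_) h2 x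
    · simpa using (F.s2 (0, x)).map π
    · rw [hs, SemiconjBy]
      simp [gtMk_mul]
  rw [← Prod.fst_add_snd v, F.exp2, map_mul, hl, hr]
  simp [gtMk_mul]

lemma map_E1 (h12 : π (e12 1) = gtMk hp 0 0 0 1 0 0 0 0 0 0 0 0)
    (h2 : ∀ v, π (E2 v) = gtMk hp 0 0 0 0 0 0 0 0 v.1 v.2 0 0) (v : ZpRing p × ZpRing p) :
    π (F.E1 v) = gtMk hp 0 0 0 0 0 v.1 v.2 0 0 0 0 0 := by
  have h := congrArg π (F.rel1 1 v)
  rw [one_smul, mul_assoc, map_mul, map_mul, map_mul, h12, h2] at h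
  apply mul_right_cancel (h.symm.trans _)
  simp [gtMk_mul]

include hs ht in
/-- The matrix of a normal form. -/
lemma map_nf (hu : π u = gtMk hp 0 0 1 0 0 0 0 0 0 0 0 0)
    (h12 : ∀ x, π (e12 x) = gtMk hp 0 0 0 x 0 0 0 0 0 0 0 0)
    (h23 : ∀ x, π (e23 x) = gtMk hp 0 0 0 0 0 0 0 x 0 0 0 0)
    (h13 : ∀ x, π (e13 x) = gtMk hp 0 0 0 0 x 0 0 0 0 0 0 0)
    (h3 : ∀ v, π (E3 v) = gtMk hp 0 0 0 0 0 0 0 0 0 0 v.1 v.2)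
    (h2 : ∀ v, π (E2 v) = gtMk hp 0 0 0 0 0 0 0 0 v.1 v.2 0 0)
    (v₁ v₂ v₃ : ZpRing p × ZpRing p) (z x y : ZpRing p) (n k m : ℤ) :
    π (F.nf v₁ v₂ v₃ z x y n k m) =
      gtMk hp n k m (x * ((ZpRing.unit hp ^ n : (ZpRing p)ˣ) : ZpRing p))
        ((x * y + z) * ((ZpRing.unit hp ^ k : (ZpRing p)ˣ) : ZpRing p))
        v₁.1 (v₁.1 * m + v₁.2)
        (y * ((ZpRing.unit hp ^ k : (ZpRing p)ˣ) : ZpRing p))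
        v₂.1 (v₂.1 * m + v₂.2) v₃.1 (v₃.1 * m + v₃.2) := by
  simp only [GtFrame.nf, map_mul, map_zpow, hs, ht, hu, h12, h23, h13, h3, h2,
    map_E1 F π (h12 1) h2, gtMk_n_zpow, gtMk_k_zpow, gtMk_m_zpow]
  simp [gtMk_mul, add_mul, mul_assoc]

end MapFrame

/-- `G̃_p` is finitely presented: it is isomorphic to a group presented
by finitely many generators and finitely many relators. -/
theorem Gt_finitely_presented (p : ℕ) (hp : p.Prime) :
    ∃ (S : Type) (_ : Fintype S) (R : Finset (FreeGroup S)),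
      Nonempty (PresentedGroup (↑R : Set (FreeGroup S)) ≃* ↥(Gt p hp)) := by
  refine ⟨Fin 10, inferInstance, (finite_gtRelators p).toFinset, ?_⟩
  rw [Set.Finite.coe_toFinset]
  obtain ⟨e12, e23, e13, E3, E2, F, h12, h23, h13, h34, h35, h24, h25⟩ :=
    (gtSystem_of p).exists_frame ZpRing.exists_pow_mul_eq
  let gen : Fin 10 → Gt p hp := ![gtMk hp 1 0 0 0 0 0 0 0 0 0 0 0,
    gtMk hp 0 1 0 0 0 0 0 0 0 0 0 0, gtMk hp 0 0 1 0 0 0 0 0 0 0 0 0,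
    gtMk hp 0 0 0 1 0 0 0 0 0 0 0 0, gtMk hp 0 0 0 0 0 0 0 1 0 0 0 0,
    gtMk hp 0 0 0 0 0 0 0 0 0 0 1 0, gtMk hp 0 0 0 0 0 0 0 0 0 0 0 1,
    gtMk hp 0 0 0 0 1 0 0 0 0 0 0 0, gtMk hp 0 0 0 0 0 0 0 0 1 0 0 0,
    gtMk hp 0 0 0 0 0 0 0 0 0 1 0 0]
  have hgen : ∀ w ∈ gtRelators p, FreeGroup.lift gen w = 1 := by
    rw [← gtSystem_iff_relators]
    simp only [FreeGroup.lift_apply_of]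
    exact gtSystem_gt hp
  let π : PresentedGroup (gtRelators p) →* Gt p hp := PresentedGroup.toGroup hgen
  have hπ (i : Fin 10) : π (.of i) = gen i := PresentedGroup.toGroup.of hgen
  have hπs : π (.of 0) = gtMk hp 1 0 0 0 0 0 0 0 0 0 0 0 := hπ 0
  have hπt : π (.of 1) = gtMk hp 0 1 0 0 0 0 0 0 0 0 0 0 := hπ 1
  have hπ12 := map_e12 F π hπs (h12 ▸ hπ 3)
  have hπ2 := map_E2 F π hπs (h24 ▸ hπ 8) (h25 ▸ hπ 9)
  have hnf := map_nf F π hπs hπt (hπ 2) hπ12 (map_e23 F π hπt (h23 ▸ hπ 4))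
    (map_e13 F π hπt (h13 ▸ hπ 7)) (map_E3 F π hπt (h34 ▸ hπ 5) (h35 ▸ hπ 6)) hπ2
  refine ⟨MulEquiv.ofBijective π ⟨?_, fun M => ?_⟩⟩
  · refine (injective_iff_map_eq_one π).mpr fun γ hγ => ?_
    obtain ⟨v₁, v₂, v₃, z, x, y, n, k, m, rfl⟩ := F.mem_nfSet (ZpRing.unit hp).mul_inv
      (PresentedGroup.closure_range_of (gtRelators p)) (by
        rintro _ ⟨i, rfl⟩
        fin_cases i
        · exact .inl rfl
        · exact .inr (.inl rfl)
        · exact .inr (.inr (.inl rfl))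
        · exact .inr (.inr (.inr (.inl ⟨1, h12.symm⟩)))
        · exact .inr (.inr (.inr (.inr (.inl ⟨1, h23.symm⟩))))
        · exact .inr (.inr (.inr (.inr (.inr (.inr (.inl ⟨_, h34.symm⟩))))))
        · exact .inr (.inr (.inr (.inr (.inr (.inr (.inl ⟨_, h35.symm⟩))))))
        · exact .inr (.inr (.inr (.inr (.inr (.inl ⟨1, h13.symm⟩)))))
        · exact .inr (.inr (.inr (.inr (.inr (.inr (.inr ⟨_, h24.symm⟩))))))
        · exact .inr (.inr (.inr (.inr (.inr (.inr (.inr ⟨_, h25.symm⟩))))))) γ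
    rw [hnf] at hγ
    obtain ⟨rfl, rfl, rfl, hx, hz, h1, h1', hy, h2, h2', h3, h3'⟩ := gtMk_eq_one hγ
    obtain ⟨v₁, w₁⟩ := v₁
    obtain ⟨v₂, w₂⟩ := v₂
    obtain ⟨v₃, w₃⟩ := v₃
    simp only [zpow_zero, Units.val_one, mul_one, Int.cast_zero, mul_zero, zero_add]
      at hx hz h1 h1' hy h2 h2' h3 h3'
    subst hx hy h1 h1' h2 h2' h3 h3'
    rw [mul_zero, zero_add] at hz
    subst hz
    have h0 : ((0, 0) : ZpRing p × ZpRing p) = 0 := rfl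
    simp [GtFrame.nf, h0, F.exp1.map_zero, F.exp2.map_zero, F.exp3.map_zero, F.exp12.map_zero,
      F.exp13.map_zero, F.exp23.map_zero]
  · obtain ⟨n, k, m, x01, x02, x03, x04, x12, x13, x14, x23, x24, rfl⟩ := exists_gtMk_eq M
    set N := ZpRing.unit hp ^ n with hN
    set K := ZpRing.unit hp ^ k with hK
    refine ⟨F.nf (x03, x04 - x03 * m) (x13, x14 - x13 * m) (x23, x24 - x23 * m)
      (x02 * ↑K⁻¹ - x01 * ↑N⁻¹ * (x12 * ↑K⁻¹)) (x01 * ↑N⁻¹) (x12 * ↑K⁻¹) n k m, ?_⟩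
    rw [hnf]
    simp [← hN, ← hK]
end
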